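/- arXiv:2306.06588 — 7 statements merged into one kernel-verified Lean document; each statement's English description precedes it below -/
import Mathlib

section
/- Suppose (n,q) ∉ {(2,2),(2,3)} and let g ∈ SL_n(𝔽_q) be a nonscalar matrix (g is not of the form a·I_n). Then P_{k,n,q} = M_n(𝔽_q) if and only if g stabilizes P_{k,n,q} under left multiplication, i.e., {g·X : X ∈ P_{k,n,q}} = P_{k,n,q}. -/
/-- The set `P_{k,n,q}` of sums of two `k`-th powers of `n × n` matrices over a field `F`. -/
def sumsOfTwoKthPowers (k n : ℕ) (F : Type*) [Field F] : Set (Matrix (Fin n) (Fin n) F) :=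
  {M | ∃ A B : Matrix (Fin n) (Fin n) F, M = A ^ k + B ^ k}

open Matrix Matrix.SpecialLinearGroup in
lemma diag2n_decompose_aux {ι F : Type*} [Field F] [DecidableEq ι] [Fintype ι] {i j : ι}
    (hij : i ≠ j) (a : F) (ha : a ≠ 0) :
    diag2n hij a ha = SpecialLinearGroup.transvection hij a *
      SpecialLinearGroup.transvection hij.symm (- a⁻¹) *
      SpecialLinearGroup.transvection hij a *
      SpecialLinearGroup.transvection hij (-1) *
      SpecialLinearGroup.transvection hij.symm 1 *
      SpecialLinearGroup.transvection hij (-1) := by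
  apply coeMonoidHom_injective
  have h : coeMonoidHom (diag2n hij a ha) = 1 + single i i (a - 1) + single j j (a⁻¹ - 1) := by
    rw [coeMonoidHom_apply, diag2n_coe]
    ext x y
    simp only [diagonal_apply, Matrix.add_apply, Matrix.one_apply, Matrix.single_apply]
    grind
  rw [h]
  simp only [map_mul, coeMonoidHom_apply, transvection_coe, mul_add, add_mul, mul_one, one_mul,
    single_mul_single_same, single_mul_single_of_ne _ _ _ _ hij,
    single_mul_single_of_ne _ _ _ _ hij.symm, add_zero, zero_add]
  ext x y
  simp only [Matrix.add_apply, Matrix.one_apply, Matrix.single_apply, Matrix.zero_apply]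
  grind

open Matrix Matrix.SpecialLinearGroup in
lemma SL_transvection_induction_aux {ι F : Type*} [Field F] [DecidableEq ι] [Fintype ι]
    [Nontrivial ι] (N : Subgroup (SpecialLinearGroup ι F))
    (h : ∀ (i j : ι) (hij : i ≠ j) (c : F), SpecialLinearGroup.transvection hij c ∈ N) :
    N = ⊤ := by
  refine eq_top_iff.2 fun M _ => diagonal_transvection_induction' (fun A => A ∈ N) M
    (fun i j hij c hc => ?_) h (fun _ _ => mul_mem)
  rw [diag2n_decompose_aux]
  exact mul_mem (mul_mem (mul_mem (mul_mem (mul_mem (h _ _ _ _) (h _ _ _ _)) (h _ _ _ _))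
    (h _ _ _ _)) (h _ _ _ _)) (h _ _ _ _)

open Matrix Matrix.SpecialLinearGroup in
/-- `SL_n(F)` has an Iwasawa structure on projective space. -/
noncomputable def SLIwasawa (ι F : Type*) [Field F] [DecidableEq ι] [Fintype ι]
    [Nontrivial ι] :
    MulAction.IwasawaStructure (SpecialLinearGroup ι F) (Projectivization F (ι → F)) where
  T p := lineStab p.submodule
  is_comm p := by
    rw [← Projectivization.mk_rep p, Projectivization.submodule_mk]
    exact lineStab_isMulCommutative_of_span p.rep p.rep_nonzero
  is_conj g p := by
    rw [PSL.smul_submodule, Matrix.SpecialLinearGroup.lineStab_smul]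
  is_generator := by
    apply SL_transvection_induction_aux
    intro i j hij c
    refine Subgroup.mem_iSup_of_mem
      (Projectivization.mk F (Pi.single i 1 : ι → F) (Pi.single_ne_zero_iff.2 one_ne_zero)) ?_
    rw [Projectivization.submodule_mk]
    exact SL2Gen.transvection_mem_lineStab hij c

lemma field_cond_aux {F : Type*} [Field F] [Finite F] (hF : 4 ≤ Nat.card F) :
    ∃ a : F, a ≠ 0 ∧ a ^ 2 ≠ 1 := by
  obtain ⟨x, hx⟩ : IsCyclic Fˣ := by infer_instance
  refine ⟨x, Units.ne_zero x, fun h ↦ ?_⟩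
  grw [Nat.card_eq_card_units_add_one F, ← orderOf_eq_card_of_forall_mem_zpowers hx,
    orderOf_le_of_pow_eq_one zero_lt_two (Units.ext <| by simpa using h)] at hF
  omega

open scoped commutatorElement in
open Matrix Matrix.SpecialLinearGroup in
lemma SL_commutator_aux {ι F : Type*} [Field F] [DecidableEq ι] [Fintype ι]
    (h3 : 3 ≤ Fintype.card ι) : commutator (SpecialLinearGroup ι F) = ⊤ := by
  have : Nontrivial ι := Fintype.one_lt_card_iff_nontrivial.1 (by omega)
  apply SL_transvection_induction_aux
  intro i j hij c
  obtain ⟨k, hk⟩ : ∃ k, k ∉ ({i, j} : Finset ι) := by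
    by_contra! hc
    have := Finset.card_le_two (a := i) (b := j)
    rw [Finset.eq_univ_iff_forall.2 hc, Finset.card_univ] at this
    omega
  simp only [Finset.mem_insert, Finset.mem_singleton, not_or] at hk
  have hik : i ≠ k := fun h => hk.1 h.symm
  have hkj : k ≠ j := hk.2
  have e : SpecialLinearGroup.transvection hij c =
      ⁅SpecialLinearGroup.transvection hik c, SpecialLinearGroup.transvection hkj (1 : F)⁆ := by
    rw [commutatorElement_def, transvection_inv, transvection_inv]
    apply coeMonoidHom_injective
    simp only [map_mul, coeMonoidHom_apply, transvection_coe, mul_add, add_mul, mul_one, one_mul,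
      single_mul_single_same, single_mul_single_of_ne _ _ _ _ hij,
      single_mul_single_of_ne _ _ _ _ hij.symm, single_mul_single_of_ne _ _ _ _ hik,
      single_mul_single_of_ne _ _ _ _ hik.symm, single_mul_single_of_ne _ _ _ _ hkj,
      single_mul_single_of_ne _ _ _ _ hkj.symm, add_zero, zero_add]
    ext x y
    simp only [Matrix.add_apply, Matrix.one_apply, Matrix.single_apply, Matrix.zero_apply]
    grind
  rw [e]
  exact Subgroup.commutator_mem_commutator (Subgroup.mem_top _) (Subgroup.mem_top _)

open Matrix Matrix.SpecialLinearGroup in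
lemma SL_normal_eq_top_aux {F : Type*} [Field F] [Fintype F] {n : ℕ} (hn : 2 ≤ n)
    (hnq2 : ¬(n = 2 ∧ Fintype.card F = 2)) (hnq3 : ¬(n = 2 ∧ Fintype.card F = 3))
    (g : Matrix.SpecialLinearGroup (Fin n) F)
    (hg : ∀ a : F, (g : Matrix (Fin n) (Fin n) F) ≠ a • (1 : Matrix (Fin n) (Fin n) F))
    (N : Subgroup (SpecialLinearGroup (Fin n) F)) [N.Normal] (hN : g ∈ N) : N = ⊤ := by
  have : Nontrivial (Fin n) := Fin.nontrivial_iff_two_le.2 hn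
  have hc : commutator (SpecialLinearGroup (Fin n) F) = ⊤ := by
    rcases hn.eq_or_lt with rfl | h
    · have h1 : 1 < Fintype.card F := Fintype.one_lt_card
      obtain ⟨a, ha, ha2⟩ := field_cond_aux (F := F) (by
        rw [Nat.card_eq_fintype_card]; omega)
      exact SL2.commutator_eq_top ha ha2
    · exact SL_commutator_aux (by rw [Fintype.card_fin]; exact h)
  rw [eq_top_iff, ← hc]
  apply (SLIwasawa (Fin n) F).commutator_le N
  intro h
  have : g ∈ (MulAction.toPermHom (Matrix.SpecialLinearGroup (Fin n) F)
      (Projectivization F (Fin n → F))).ker := by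
    rw [MonoidHom.mem_ker]
    ext1 x
    have hx : x ∈ MulAction.fixedPoints N (Projectivization F (Fin n → F)) := h ▸ Set.mem_univ x
    exact hx ⟨g, hN⟩
  rw [Projectivization.SL_mulAction_ker, Matrix.SpecialLinearGroup.mem_center_iff] at this
  obtain ⟨r, -, hr⟩ := this
  refine hg r ?_
  rw [← hr, Matrix.smul_one_eq_diagonal]
  rfl

open Matrix in
lemma exists_det_aux {F : Type*} [Field F] {k n : ℕ} (hk : 1 ≤ k) (hn : 2 ≤ n) (d : F) :
    ∃ X ∈ sumsOfTwoKthPowers k n F, X.det = d := by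
  have : Nontrivial (Fin n) := Fin.nontrivial_iff_two_le.2 hn
  obtain ⟨i, j, hij⟩ := exists_pair_ne (Fin n)
  have idem : ∀ A : Matrix (Fin n) (Fin n) F, A * A = A → A ^ k = A := fun A h =>
    IsIdempotentElem.pow_eq (by exact h) (by omega)
  let u : Fin n → F := Pi.single i (1 - d) + Pi.single j d
  let v : Fin n → F := Pi.single i 1 + Pi.single j 1
  let e : Fin n → F := Pi.single j 1
  have hvu : v ⬝ᵥ u = 1 := by
    simp [u, v, hij, hij.symm, add_dotProduct]
  have hee : e ⬝ᵥ e = 1 := by simp [e]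
  have hve : v ⬝ᵥ e = 1 := by simp [v, e, hij]
  have heu : e ⬝ᵥ u = d := by simp [u, e, hij.symm]
  refine ⟨(1 - vecMulVec e e) + vecMulVec u v, ⟨1 - vecMulVec e e, vecMulVec u v, ?_⟩, ?_⟩
  · rw [idem, idem]
    · simp [vecMulVec_mul_vecMulVec, hvu]
    · simp [sub_mul, mul_sub, vecMulVec_mul_vecMulVec, hee]
  · have : (1 - vecMulVec e e) + vecMulVec u v =
      1 + (Matrix.of fun x (y : Fin 2) => (![- e x, u x] : Fin 2 → F) y) *
        (Matrix.of fun (y : Fin 2) x => (![e x, v x] : Fin 2 → F) y) := by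
      ext x y
      simp [Matrix.mul_apply, Fin.sum_univ_two, vecMulVec_apply]
      ring
    rw [this, det_one_add_mul_comm]
    have h2 : ((Matrix.of fun (y : Fin 2) x => (![e x, v x] : Fin 2 → F) y) *
      (Matrix.of fun x (y : Fin 2) => (![- e x, u x] : Fin 2 → F) y)) = !![-1, d; -1, 1] := by
      rw [dotProduct] at hvu hee hve heu
      ext x y
      fin_cases x <;> fin_cases y <;> simp [Matrix.mul_apply, hvu, hee, hve, heu]
    rw [h2, det_fin_two]
    simp

open Matrix in
lemma conj_mem_aux {F : Type*} [Field F] {k n : ℕ} (h : Matrix.SpecialLinearGroup (Fin n) F)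
    {X : Matrix (Fin n) (Fin n) F} (hX : X ∈ sumsOfTwoKthPowers k n F) :
    h.1 * X * (h⁻¹).1 ∈ sumsOfTwoKthPowers k n F := by
  obtain ⟨A, B, rfl⟩ := hX
  have h1 : (h⁻¹).1 * h.1 = 1 := congrArg Subtype.val (inv_mul_cancel h)
  have h2 : h.1 * (h⁻¹).1 = 1 := congrArg Subtype.val (mul_inv_cancel h)
  let U : (Matrix (Fin n) (Fin n) F)ˣ := ⟨h.1, (h⁻¹).1, h2, h1⟩
  refine ⟨h.1 * A * (h⁻¹).1, h.1 * B * (h⁻¹).1, ?_⟩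
  have := Units.conj_pow U A k
  have := Units.conj_pow U B k
  simp_all [U, mul_add, add_mul]

theorem stmt0 (F : Type*) [Field F] [Fintype F] (k n : ℕ) (hk : 1 ≤ k) (hn : 2 ≤ n)
    (hnq2 : ¬(n = 2 ∧ Fintype.card F = 2)) (hnq3 : ¬(n = 2 ∧ Fintype.card F = 3))
    (g : Matrix.SpecialLinearGroup (Fin n) F)
    (hg : ∀ a : F, (g : Matrix (Fin n) (Fin n) F) ≠ a • (1 : Matrix (Fin n) (Fin n) F)) :
    sumsOfTwoKthPowers k n F = Set.univ ↔
      (fun X => (g : Matrix (Fin n) (Fin n) F) * X) '' sumsOfTwoKthPowers k n F =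
        sumsOfTwoKthPowers k n F := by
  classical
  have inv1 : ∀ h : Matrix.SpecialLinearGroup (Fin n) F, (h⁻¹).1 * h.1 = 1 := fun h => by
    rw [← Matrix.SpecialLinearGroup.coe_mul]; simp
  have inv2 : ∀ h : Matrix.SpecialLinearGroup (Fin n) F, h.1 * (h⁻¹).1 = 1 := fun h => by
    rw [← Matrix.SpecialLinearGroup.coe_mul]; simp
  constructor
  · intro h
    rw [h, Set.image_univ, Set.eq_univ_iff_forall]
    intro X
    exact ⟨(g⁻¹).1 * X, by simp only [← mul_assoc, inv2, one_mul]⟩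
  intro hgP
  -- the left stabilizer
  let N : Subgroup (Matrix.SpecialLinearGroup (Fin n) F) :=
    { carrier := {h | ∀ X, h.1 * X ∈ sumsOfTwoKthPowers k n F ↔ X ∈ sumsOfTwoKthPowers k n F}
      one_mem' := fun X => by simp
      mul_mem' := fun {a b} ha hb X => by
        rw [Matrix.SpecialLinearGroup.coe_mul, mul_assoc, ha, hb]
      inv_mem' := fun {a} ha X => by
        rw [← ha, ← mul_assoc, inv2, one_mul] }
  have hNm : ∀ h, h ∈ N ↔
    ∀ X, h.1 * X ∈ sumsOfTwoKthPowers k n F ↔ X ∈ sumsOfTwoKthPowers k n F := fun h => Iff.rfl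
  have conj_iff : ∀ (h : Matrix.SpecialLinearGroup (Fin n) F) (X : Matrix (Fin n) (Fin n) F),
      h.1 * X * (h⁻¹).1 ∈ sumsOfTwoKthPowers k n F ↔ X ∈ sumsOfTwoKthPowers k n F := by
    refine fun h X => ⟨fun hX => ?_, conj_mem_aux h⟩
    have := conj_mem_aux h⁻¹ hX
    rwa [inv_inv, ← mul_assoc, ← mul_assoc, inv1, one_mul, mul_assoc, inv1, mul_one] at this
  have hgN : g ∈ N := by
    rw [hNm]
    intro X
    constructor
    · intro h
      rw [← hgP] at h
      obtain ⟨Y, hY, hYX⟩ := h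
      have : (g⁻¹).1 * (g.1 * Y) = (g⁻¹).1 * (g.1 * X) := by
        simpa using congrArg ((g⁻¹).1 * ·) hYX
      rw [← mul_assoc, ← mul_assoc, inv1, one_mul, one_mul] at this
      rwa [← this]
    · intro h
      rw [← hgP]
      exact ⟨X, h, rfl⟩
  have hNn : N.Normal := by
    refine ⟨fun a ha h => ?_⟩
    rw [hNm] at ha ⊢
    intro X
    have : (h * a * h⁻¹).1 * X = h.1 * (a.1 * ((h⁻¹).1 * X * ((h⁻¹)⁻¹).1)) * (h⁻¹).1 := by
      simp only [Matrix.SpecialLinearGroup.coe_mul, inv_inv, mul_assoc, inv2, mul_one]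
    rw [this, conj_iff, ha, conj_iff]
  have hN : N = ⊤ := SL_normal_eq_top_aux hn hnq2 hnq3 g hg N hgN
  have left : ∀ (h : Matrix.SpecialLinearGroup (Fin n) F) (X : Matrix (Fin n) (Fin n) F),
      h.1 * X ∈ sumsOfTwoKthPowers k n F ↔ X ∈ sumsOfTwoKthPowers k n F := fun h =>
    (hNm h).1 (hN ▸ Subgroup.mem_top h)
  have right : ∀ (h : Matrix.SpecialLinearGroup (Fin n) F) (X : Matrix (Fin n) (Fin n) F),
      X * h.1 ∈ sumsOfTwoKthPowers k n F ↔ X ∈ sumsOfTwoKthPowers k n F := fun h X => by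
    rw [← conj_iff h, ← mul_assoc, mul_assoc _ h.1, inv2, mul_one, left]
  rw [Set.eq_univ_iff_forall]
  intro M
  by_cases hM : M.det = 0
  · obtain ⟨L, L', D, rfl⟩ := Matrix.Pivot.exists_list_transvec_mul_diagonal_mul_list_transvec M
    have l1 := left ⟨_, Matrix.TransvectionStruct.det_toMatrix_prod L⟩
    have l2 := right ⟨_, Matrix.TransvectionStruct.det_toMatrix_prod L'⟩
    rw [l2, l1]
    simp only [Matrix.det_mul, Matrix.TransvectionStruct.det_toMatrix_prod, one_mul, mul_one,
      Matrix.det_diagonal] at hM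
    obtain ⟨i, -, hi⟩ := Finset.prod_eq_zero_iff.1 hM
    let c : F := ∏ x ∈ Finset.univ.erase i, if D x = 0 then 1 else D x
    have hc : c ≠ 0 := Finset.prod_ne_zero_iff.2 fun x _ => by split_ifs <;> simp_all
    let E : Fin n → F := fun x => if x = i then c⁻¹ else if D x = 0 then 1 else D x
    have hE : (Matrix.diagonal E).det = 1 := by
      rw [Matrix.det_diagonal, ← Finset.mul_prod_erase _ _ (Finset.mem_univ i)]
      have : ∏ x ∈ Finset.univ.erase i, E x = c := Finset.prod_congr rfl fun x hx => by
        simp [E, Finset.ne_of_mem_erase hx]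
      rw [this]
      simp [E, hc]
    have hD : Matrix.diagonal D = Matrix.diagonal E *
        Matrix.diagonal (fun x => if D x = 0 then 0 else 1) := by
      rw [Matrix.diagonal_mul_diagonal]
      congr 1
      ext x
      by_cases hx : D x = 0
      · simp [hx]
      · have : x ≠ i := fun h => hx (h ▸ hi)
        simp [E, hx, this]
    have l3 := left ⟨_, hE⟩
    rw [hD, l3]
    refine ⟨Matrix.diagonal (fun x => if D x = 0 then 0 else 1), 0, ?_⟩
    rw [zero_pow (by omega), add_zero, Matrix.diagonal_pow]
    congr 1
    ext x
    by_cases hx : D x = 0 <;> simp [hx, show k ≠ 0 by omega]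
  · obtain ⟨X, hX, hdet⟩ := exists_det_aux (F := F) hk hn M.det
    have hu : IsUnit X.det := by rw [hdet]; exact isUnit_iff_ne_zero.2 hM
    have h1 : (M * X⁻¹).det = 1 := by
      rw [Matrix.det_mul, Matrix.det_nonsing_inv, hdet, Ring.inverse_eq_inv', mul_inv_cancel₀ hM]
    have := (left ⟨_, h1⟩ X).2 hX
    rwa [mul_assoc, Matrix.nonsing_inv_mul _ hu, mul_one] at this
end

section
/- If q ≥ 4 and gcd(k, q−1) = 1, then every matrix in M_n(𝔽_q) can be written as A^k + B^k where A and B are invertible split semisimple matrices in M_n(𝔽_q). -/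
/-- A matrix over a field is split semisimple (diagonalizable) if it is
similar over the field to a diagonal matrix. -/
def IsSplitSemisimple {n : ℕ} {F : Type*} [Field F]
    (A : Matrix (Fin n) (Fin n) F) : Prop :=
  ∃ (g : GL (Fin n) F) (d : Fin n → F),
    (↑g : Matrix (Fin n) (Fin n) F) * A * (↑g⁻¹ : Matrix (Fin n) (Fin n) F) =
      Matrix.diagonal d

open Polynomial in
lemma aux_fix_three {F V : Type*} [Field F] [Fintype F] [AddCommGroup V] [Module F V]
    (T : Module.End F V) {a b c : F} (ha : a ≠ 0) (hb : b ≠ 0) (hc : c ≠ 0)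
    (hab : a ≠ b) (hac : a ≠ c) (hbc : b ≠ c) (v : V)
    (h : aeval T ((X - C a) * (X - C b) * (X - C c) : F[X]) v = 0) :
    (T ^ (Fintype.card F - 1)) v = v := by
  have hd : ∀ x : F, x ≠ 0 → (X - C x : F[X]) ∣ X ^ (Fintype.card F - 1) - 1 := by
    intro x hx
    rw [dvd_iff_isRoot]
    simp [FiniteField.pow_card_sub_one_eq_one x hx]
  have hcop : ∀ x y : F, x ≠ y → IsCoprime (X - C x : F[X]) (X - C y) := fun x y hxy =>
    isCoprime_X_sub_C_of_isUnit_sub (sub_ne_zero.2 hxy).isUnit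
  have hdvd : ((X - C a) * (X - C b) * (X - C c) : F[X]) ∣ X ^ (Fintype.card F - 1) - 1 := by
    refine IsCoprime.mul_dvd ?_ (IsCoprime.mul_dvd (hcop _ _ hab) (hd a ha) (hd b hb)) (hd c hc)
    exact IsCoprime.mul_left (hcop _ _ hac) (hcop _ _ hbc)
  obtain ⟨r, hr⟩ := hdvd
  have h2 : aeval T (X ^ (Fintype.card F - 1) - 1 : F[X]) v = 0 := by
    rw [hr, mul_comm, map_mul, Module.End.mul_apply, h, map_zero]
  simpa [sub_eq_zero] using h2

lemma aux_fix_one {F V : Type*} [Field F] [Fintype F] [AddCommGroup V] [Module F V]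
    (T : Module.End F V) {a : F} (ha : a ≠ 0) (v : V) (h : T v = a • v) :
    (T ^ (Fintype.card F - 1)) v = v := by
  have : ∀ k : ℕ, (T ^ k) v = a ^ k • v := by
    intro k
    induction k with
    | zero => simp
    | succ k ih => rw [pow_succ', Module.End.mul_apply, ih, map_smul, h, smul_smul, pow_succ]
  rw [this, FiniteField.pow_card_sub_one_eq_one a ha, one_smul]

lemma aux_fix_two {F V : Type*} [Field F] [Fintype F] [AddCommGroup V] [Module F V]
    (T : Module.End F V) {x y : F} (hx : x ≠ 0) (hy : y ≠ 0) (hxy : x ≠ y) (v w : V)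
    (hv : T v = x • v + w) (hw : T w = y • w) :
    (T ^ (Fintype.card F - 1)) v = v := by
  have hs : x - y ≠ 0 := sub_ne_zero.2 hxy
  have h1 := aux_fix_one T hy w hw
  have h2 := aux_fix_one T hx (v + (x - y)⁻¹ • w) (by
    rw [map_add, map_smul, hv, hw, smul_add, smul_smul, smul_smul, add_assoc]
    congr 1
    nth_rewrite 1 [← one_smul F w]
    rw [← add_smul]
    congr 1
    field_simp
    ring)
  rw [map_add, map_smul, h1] at h2
  exact add_right_cancel h2

lemma aux_choice {F : Type*} [Field F] [Fintype F] (hF : 4 ≤ Fintype.card F) (t : F) :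
    ∃ a b c : F, a ≠ 0 ∧ b ≠ 0 ∧ c ≠ 0 ∧ a ≠ b ∧ a ≠ c ∧ b ≠ c ∧ t - c ≠ 0 ∧ -a ≠ t - c := by
  classical
  have key : ∀ s : Finset F, s.card ≤ 3 → ∃ x, x ∉ s := by
    intro s hs
    by_contra! h
    have : s = Finset.univ := Finset.eq_univ_iff_forall.2 h
    rw [this, Finset.card_univ] at hs
    omega
  obtain ⟨c, hc⟩ := key {0, t} (Finset.card_le_two.trans (by norm_num))
  obtain ⟨a, ha⟩ := key {0, c, c - t} Finset.card_le_three
  obtain ⟨b, hb⟩ := key {0, c, a} Finset.card_le_three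
  simp only [Finset.mem_insert, Finset.mem_singleton, not_or] at hc ha hb
  refine ⟨a, b, c, ha.1, hb.1, hc.1, Ne.symm hb.2.2, ha.2.1, hb.2.1, ?_, ?_⟩
  · exact sub_ne_zero.2 (Ne.symm hc.2)
  · intro h
    apply ha.2.2
    linear_combination -h

/-- The sum-decomposition property for an endomorphism. -/
def AuxGood {F V : Type*} [Field F] [Fintype F] [AddCommGroup V] [Module F V]
    (f : Module.End F V) : Prop :=
  ∃ A B : Module.End F V, f = A + B ∧ A ^ (Fintype.card F - 1) = 1 ∧
    B ^ (Fintype.card F - 1) = 1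

open Polynomial in
lemma aux_cyclic {F V : Type*} [Field F] [Fintype F] (hF : 4 ≤ Fintype.card F)
    [AddCommGroup V] [Module F V]
    (f : Module.End F V) (m : ℕ) (e : Module.Basis (Fin (m + 1)) F V)
    (h : ∀ i : Fin m, f (e i.succ) = e i.castSucc) : AuxGood f := by
  classical
  set t : F := e.repr (f (e 0)) 0 with ht
  obtain ⟨a, b, c, ha, hb, hc, hab, hac, hbc, htc, hatc⟩ := aux_choice hF t
  let A : Module.End F V := e.constr F (fun j : Fin (m + 1) =>
    if j = 0 then c • e 0 + (f (e 0) - t • e 0)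
    else if Odd (j : ℕ) then a • e j else b • e j + f (e j))
  have A0 : A (e 0) = c • e 0 + (f (e 0) - t • e 0) := by
    simp only [A, Module.Basis.constr_basis, if_true]
  have Aodd : ∀ j : Fin (m + 1), Odd (j : ℕ) → A (e j) = a • e j := by
    intro j hj
    have : j ≠ 0 := by rintro rfl; simp at hj
    simp only [A, Module.Basis.constr_basis, if_neg this, if_pos hj]
  have Aev : ∀ j : Fin (m + 1), j ≠ 0 → ¬ Odd (j : ℕ) → A (e j) = b • e j + f (e j) := by
    intro j h0 hj
    simp only [A, Module.Basis.constr_basis, if_neg h0, if_neg hj]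
  have hAW : ∀ j : Fin m, aeval A ((X - C a) * (X - C b) : F[X]) (e j.succ) = 0 := by
    intro j
    by_cases hj : Odd (j.succ : ℕ)
    · rw [mul_comm]
      simp [Aodd _ hj]
    · have hj' : Odd (j.castSucc : ℕ) := by
        simp only [Fin.val_succ, Fin.val_castSucc] at hj ⊢
        by_contra hc
        exact hj (Nat.not_odd_iff_even.1 hc).add_one
      simp [Aev _ (Fin.succ_ne_zero j) hj, h, Aodd _ hj']
  refine ⟨A, f - A, by abel, ?_, ?_⟩
  · refine e.ext fun j => ?_
    rw [Module.End.one_apply]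
    refine Fin.cases ?_ (fun j => ?_) j
    · refine aux_fix_three A ha hb hc hab hac hbc _ ?_
      rw [map_mul, Module.End.mul_apply]
      have h1 : aeval A (X - C c : F[X]) (e 0) = f (e 0) - t • e 0 := by
        simp [A0]
      have h2 : f (e 0) - t • e 0 = ∑ i : Fin m, e.repr (f (e 0)) i.succ • e i.succ := by
        nth_rewrite 1 [← e.sum_repr (f (e 0))]
        rw [Fin.sum_univ_succ, ht]
        abel
      rw [h1, h2, map_sum]
      refine Finset.sum_eq_zero fun i _ => ?_
      rw [map_smul, hAW, smul_zero]
    · refine aux_fix_three A ha hb hc hab hac hbc _ ?_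
      rw [mul_comm, map_mul, Module.End.mul_apply, hAW, map_zero]
  · refine e.ext fun j => ?_
    rw [Module.End.one_apply]
    have B0 : (f - A) (e 0) = (t - c) • e 0 := by
      rw [LinearMap.sub_apply, A0, sub_smul]; abel
    have Bev : ∀ j : Fin (m + 1), j ≠ 0 → ¬ Odd (j : ℕ) → (f - A) (e j) = (-b) • e j := by
      intro j h0 hj
      rw [LinearMap.sub_apply, Aev j h0 hj, neg_smul]; abel
    refine Fin.cases ?_ (fun j => ?_) j
    · exact aux_fix_one _ htc _ B0
    · by_cases hj : Odd (j.succ : ℕ)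
      · have hBj : (f - A) (e j.succ) = (-a) • e j.succ + e j.castSucc := by
          rw [LinearMap.sub_apply, Aodd _ hj, neg_smul, h]; abel
        by_cases h0 : j.castSucc = 0
        · refine aux_fix_two _ (neg_ne_zero.2 ha) htc hatc _ _ hBj ?_
          rw [h0, B0]
        · refine aux_fix_two _ (neg_ne_zero.2 ha) (neg_ne_zero.2 hb) (neg_injective.ne hab) _ _
            hBj (Bev _ h0 ?_)
          simp only [Fin.val_succ, Fin.val_castSucc] at hj ⊢
          intro hj'
          exact (Nat.not_odd_iff_even.2 hj'.add_one) hj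
      · exact aux_fix_one _ (neg_ne_zero.2 hb) _ (Bev _ (Fin.succ_ne_zero j) hj)

lemma aux_conj {F V W : Type*} [Field F] [Fintype F] [AddCommGroup V] [Module F V]
    [AddCommGroup W] [Module F W] (φ : V ≃ₗ[F] W) (f : Module.End F V) (g : Module.End F W)
    (hfg : ∀ v, φ (f v) = g (φ v)) (hg : AuxGood g) : AuxGood f := by
  obtain ⟨A, B, h, hA, hB⟩ := hg
  let ψ := φ.symm.conjRingEquiv
  refine ⟨ψ A, ψ B, ?_, ?_, ?_⟩
  · rw [← map_add, ← h]
    ext v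
    apply φ.injective
    simp [ψ, hfg]
  · rw [← map_pow, hA, map_one]
  · rw [← map_pow, hB, map_one]

open DirectSum in
lemma aux_sum {F ι : Type*} [Field F] [Fintype F] (V : ι → Type*)
    [∀ i, AddCommGroup (V i)] [∀ i, Module F (V i)] (f : ∀ i, Module.End F (V i))
    (hf : ∀ i, AuxGood (f i)) : AuxGood (V := ⨁ i, V i) (DirectSum.lmap f) := by
  classical
  choose A B h hA hB using hf
  have hp : ∀ (A : ∀ i, Module.End F (V i)) (k : ℕ) (x : ⨁ i, V i) (i : ι),
      (((DirectSum.lmap A : Module.End F (⨁ i, V i)) ^ k) x) i = (A i ^ k) (x i) := by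
    intro A k
    induction k with
    | zero => intro x i; simp
    | succ k ih => intro x i; rw [pow_succ, Module.End.mul_apply, ih, pow_succ]; rfl
  refine ⟨DirectSum.lmap A, DirectSum.lmap B, ?_, ?_, ?_⟩
  · apply LinearMap.ext
    intro x
    refine DFinsupp.ext fun i => ?_
    rw [LinearMap.add_apply]
    change f i (x i) = A i (x i) + B i (x i)
    rw [h i, LinearMap.add_apply]
  · apply LinearMap.ext
    intro x
    refine DFinsupp.ext fun i => ?_
    rw [hp, hA]; rfl
  · apply LinearMap.ext
    intro x
    refine DFinsupp.ext fun i => ?_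
    rw [hp, hB]; rfl

open Polynomial in
lemma aux_adjoin {F : Type*} [Field F] [Fintype F] (hF : 4 ≤ Fintype.card F) (g : F[X])
    (hg : g ≠ 0) :
    AuxGood (LinearMap.mulLeft F (AdjoinRoot.root g) : Module.End F (AdjoinRoot g)) := by
  let pb := AdjoinRoot.powerBasis hg
  have hgen : pb.gen = AdjoinRoot.root g := AdjoinRoot.powerBasis_gen hg
  rcases hd : pb.dim with _ | m
  · have e : Module.Basis (Fin 0) F (AdjoinRoot g) := pb.basis.reindex (finCongr hd)
    refine ⟨1, 1, e.ext fun i => i.elim0, ?_, ?_⟩ <;> exact one_pow _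
  · let e : Module.Basis (Fin (m + 1)) F (AdjoinRoot g) :=
      pb.basis.reindex ((finCongr hd).trans Fin.revPerm)
    have he : ∀ i, e i = AdjoinRoot.root g ^ (m - (i : ℕ)) := by
      intro i
      simp only [e, Module.Basis.reindex_apply, PowerBasis.coe_basis, hgen]
      congr 1
      simp [Fin.val_rev]
    refine aux_cyclic hF _ m e fun i => ?_
    rw [he, he, LinearMap.mulLeft_apply, ← pow_succ']
    congr 1
    simp only [Fin.val_succ, Fin.val_castSucc]
    omega

open Polynomial DirectSum in
lemma aux_main {F V : Type*} [Field F] [Fintype F] (hF : 4 ≤ Fintype.card F)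
    [AddCommGroup V] [Module F V] [FiniteDimensional F V] (f : Module.End F V) : AuxGood f := by
  obtain ⟨ι, _, p, hp, e, ⟨φ⟩⟩ := Module.equiv_directSum_of_isTorsion
    (R := F[X]) (M := Module.AEval' f) (Module.AEval.isTorsion_of_finiteDimensional F V f)
  let Q : ι → Type _ := fun i => F[X] ⧸ Submodule.span F[X] {p i ^ e i}
  let L : ∀ i, Module.End F (Q i) := fun i => Algebra.lsmul F F (Q i) (X : F[X])
  have hL : ∀ i, AuxGood (L i) := by
    intro i
    have := aux_adjoin hF (p i ^ e i) (pow_ne_zero _ (hp i).ne_zero)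
    refine aux_conj (W := AdjoinRoot (p i ^ e i)) (LinearEquiv.refl F _) (L i) _ ?_ this
    intro v
    induction v using Submodule.Quotient.induction_on with
    | _ v => rfl
  have hs := aux_sum Q L hL
  let φ' : Module.AEval' f ≃ₗ[F] ⨁ i, Q i := φ.restrictScalars F
  refine aux_conj ((Module.AEval'.of f).trans φ') f _ ?_ hs
  intro v
  change φ (Module.AEval'.of f (f v)) = _
  rw [← Module.AEval'.X_smul_of, map_smul]
  rfl

open Polynomial in
lemma aux_diag {F : Type*} [Field F] [Fintype F] {n : ℕ} (A : Matrix (Fin n) (Fin n) F)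
    (hA : A ^ (Fintype.card F - 1) = 1) : IsSplitSemisimple A := by
  classical
  let s : Set (Fin n → F) := {v | ∃ μ : F, A.mulVec v = μ • v}
  have hAq : aeval A (Lagrange.nodal Finset.univ (id : F → F)) = 0 := by
    have h1 : Lagrange.nodal Finset.univ (id : F → F) = X ^ Fintype.card F - X := by
      rw [Lagrange.nodal_eq]
      have hq : 1 < Fintype.card F := Fintype.one_lt_card
      have hr := FiniteField.roots_X_pow_card_sub_X F
      have hm : (X ^ Fintype.card F - X : F[X]).Monic := by
        apply monic_X_pow_sub
        rw [degree_X]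
        exact_mod_cast hq
      have := prod_multiset_X_sub_C_of_monic_of_roots_card_eq hm (by
        rw [hr, FiniteField.X_pow_card_sub_X_natDegree_eq F hq]
        simp)
      rw [hr] at this
      exact this
    rw [h1]
    have : A ^ Fintype.card F = A := by
      obtain ⟨r, hr⟩ : ∃ r, Fintype.card F = r + 1 :=
        Nat.exists_eq_succ_of_ne_zero Fintype.card_ne_zero
      rw [hr] at hA ⊢
      rw [pow_succ]
      simp at hA
      rw [hA, one_mul]
    simp [this]
  have hs : ⊤ ≤ Submodule.span F s := by
    intro v _
    have h1 : (1 : Matrix (Fin n) (Fin n) F) =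
        ∑ a : F, aeval A (Lagrange.basis Finset.univ (id : F → F) a) := by
      rw [← map_sum, Lagrange.sum_basis (Set.injOn_id _) Finset.univ_nonempty, map_one]
    rw [← Matrix.one_mulVec v, h1, Matrix.sum_mulVec]
    refine Submodule.sum_mem _ fun a _ => Submodule.subset_span ⟨a, ?_⟩
    have h2 : (A - algebraMap F _ a) * aeval A (Lagrange.basis Finset.univ (id : F → F) a) = 0 := by
      have h3 : A - algebraMap F _ a = aeval A (X - C a : F[X]) := by simp
      rw [h3, ← map_mul, Lagrange.basis_eq_prod_sub_inv_mul_nodal_div (Finset.mem_univ a),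
        ← Lagrange.nodal_erase_eq_nodal_div (Finset.mem_univ a), mul_left_comm]
      have := Lagrange.nodal_eq_mul_nodal_erase (v := (id : F → F)) (Finset.mem_univ a)
      rw [id] at this
      rw [← this, map_mul, hAq, mul_zero]
    rw [sub_mul, sub_eq_zero, ← Algebra.smul_def] at h2
    rw [Matrix.mulVec_mulVec, h2, Matrix.smul_mulVec]
  let b0 := Module.Basis.ofSpan hs
  have hb0 : ∀ i, b0 i ∈ s := fun i => Module.Basis.ofSpan_subset hs ⟨i, rfl⟩
  let b : Module.Basis (Fin n) F (Fin n → F) :=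
    b0.reindex (b0.indexEquiv (Pi.basisFun F (Fin n)))
  have hb : ∀ i, ∃ μ : F, A.mulVec (b i) = μ • b i := by
    intro i
    simp only [b, Module.Basis.reindex_apply]
    exact hb0 _
  choose d hd using hb
  let P : Matrix (Fin n) (Fin n) F := Matrix.of fun i j => b j i
  have hP : IsUnit P := by
    rw [← Matrix.linearIndependent_cols_iff_isUnit]
    exact b.linearIndependent
  obtain ⟨u, hu⟩ := hP
  refine ⟨u⁻¹, d, ?_⟩
  have hAP : A * P = P * Matrix.diagonal d := by
    ext i j
    rw [Matrix.mul_diagonal]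
    have := congrFun (hd j) i
    rw [Pi.smul_apply, smul_eq_mul, mul_comm] at this
    exact this
  rw [inv_inv, hu, mul_assoc, hAP, ← hu, ← mul_assoc]
  rw [Units.inv_mul, one_mul]

theorem stmt3 (F : Type*) [Field F] [Fintype F] (hF : 4 ≤ Fintype.card F)
    (k n : ℕ) (hk : 1 ≤ k) (hn : 2 ≤ n)
    (hkq : Nat.gcd k (Fintype.card F - 1) = 1) :
    ∀ M : Matrix (Fin n) (Fin n) F, ∃ A B : Matrix (Fin n) (Fin n) F,
      IsUnit A ∧ IsUnit B ∧ IsSplitSemisimple A ∧ IsSplitSemisimple B ∧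
        M = A ^ k + B ^ k := by
  intro M
  obtain ⟨A', B', h, hA', hB'⟩ := aux_main hF (Matrix.toLin' M)
  let ψ := (Matrix.toLinAlgEquiv' (R := F) (n := Fin n)).symm
  have root : ∀ A : Matrix (Fin n) (Fin n) F, A ^ (Fintype.card F - 1) = 1 →
      ∃ R : Matrix (Fin n) (Fin n) F, R ^ k = A ∧ R ^ (Fintype.card F - 1) = 1 := by
    intro A hA
    obtain ⟨l, hl⟩ := Nat.exists_mul_mod_eq_one_of_coprime (n := k) (k := Fintype.card F - 1)
      hkq (by omega)
    refine ⟨A ^ l, ?_, by rw [← pow_mul, mul_comm, pow_mul, hA, one_pow]⟩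
    rw [← pow_mul, mul_comm, ← Nat.div_add_mod (k * l) (Fintype.card F - 1), hl.2, pow_add, pow_mul,
      hA, one_pow, one_mul, pow_one]
  obtain ⟨A, hA, hA1⟩ := root (ψ A') (by rw [← map_pow, hA', map_one])
  obtain ⟨B, hB, hB1⟩ := root (ψ B') (by rw [← map_pow, hB', map_one])
  have hq : Fintype.card F - 1 ≠ 0 := by omega
  refine ⟨A, B, IsUnit.of_pow_eq_one hA1 hq, IsUnit.of_pow_eq_one hB1 hq, aux_diag A hA1,
    aux_diag B hB1, ?_⟩
  rw [hA, hB, ← map_add, ← h]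
  exact (Matrix.toLinAlgEquiv'.symm_apply_apply M).symm
end

section
/- If q = 2 and k is odd, then every matrix in M_n(𝔽_2) can be written as A^k + B^k with A, B ∈ M_n(𝔽_2). -/
open Module in
theorem nc_glue {V : Type} [AddCommGroup V] [Module (ZMod 2) V]
    (f : Module.End (ZMod 2) V) (W : Submodule (ZMod 2) V) (hW : ∀ w ∈ W, f w ∈ W)
    (h1 : ∀ g : Module.End (ZMod 2) W, ∃ E : Module.End (ZMod 2) W,
      E * E = E ∧ IsNilpotent (g - E))
    (h2 : ∀ g : Module.End (ZMod 2) (V ⧸ W), ∃ E : Module.End (ZMod 2) (V ⧸ W),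
      E * E = E ∧ IsNilpotent (g - E)) :
    ∃ E : Module.End (ZMod 2) V, E * E = E ∧ IsNilpotent (f - E) := by
  obtain ⟨E1, hE1, a, ha⟩ := h1 (f.restrict hW)
  obtain ⟨E2, hE2, b, hb⟩ := h2 (W.mapQ W f hW)
  obtain ⟨s, hs⟩ := W.mkQ.exists_rightInverse_of_surjective (by simp)
  obtain ⟨p0, hp0⟩ := W.subtype.exists_leftInverse_of_injective (by simp)
  have hs' : ∀ y, W.mkQ (s y) = y := fun y => LinearMap.congr_fun hs y
  have hp0' : ∀ w : W, p0 (w : V) = w := fun y => LinearMap.congr_fun hp0 y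
  obtain ⟨p, hp, hps⟩ : ∃ p : V →ₗ[ZMod 2] W, (∀ w : W, p (w : V) = w) ∧ ∀ y, p (s y) = 0 := by
    refine ⟨p0 - p0 ∘ₗ s ∘ₗ W.mkQ, ?_, ?_⟩
    · intro w
      have : W.mkQ (w : V) = 0 := by simp
      simp only [LinearMap.sub_apply, LinearMap.comp_apply, this, map_zero, sub_zero, hp0']
    · intro y
      have := hs' y
      simp only [LinearMap.sub_apply, LinearMap.comp_apply, this, sub_self]
  have hq : ∀ w : W, W.mkQ (w : V) = 0 := by intro w; simp
  have e1 : ∀ w, E1 (E1 w) = E1 w := fun w => LinearMap.congr_fun hE1 w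
  have e2 : ∀ w, E2 (E2 w) = E2 w := fun w => LinearMap.congr_fun hE2 w
  let E : Module.End (ZMod 2) V := W.subtype ∘ₗ E1 ∘ₗ p + s ∘ₗ E2 ∘ₗ W.mkQ
  have hE : ∀ x, E x = (E1 (p x) : V) + s (E2 (W.mkQ x)) := fun x => rfl
  refine ⟨E, ?_, a + b, ?_⟩
  · ext x
    rw [Module.End.mul_apply, hE, hE]
    simp only [map_add, hp, hps, hq, hs', e1, e2, add_zero, zero_add]
  · have k1 : ∀ (j : ℕ) (w : W), ((f - E) ^ j) (w : V) = (((f.restrict hW - E1) ^ j) w : W) := by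
      intro j
      induction j with
      | zero => intro w; simp
      | succ j ih =>
        intro w
        rw [pow_succ, pow_succ, Module.End.mul_apply, Module.End.mul_apply, ← ih]
        congr 1
        rw [LinearMap.sub_apply, hE, hp, hq]
        simp
    have k2 : ∀ (j : ℕ) (x : V), W.mkQ (((f - E) ^ j) x) = ((W.mapQ W f hW - E2) ^ j) (W.mkQ x) := by
      intro j
      induction j with
      | zero => intro w; simp
      | succ j ih =>
        intro w
        rw [pow_succ, pow_succ, Module.End.mul_apply, Module.End.mul_apply, ih]
        congr 1
        rw [LinearMap.sub_apply, hE, map_sub, map_add, hs', hq, zero_add]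
        simp
    ext x
    have h3 := k2 b x
    rw [hb, LinearMap.zero_apply] at h3
    have h4 : ((f - E) ^ b) x ∈ W := by simpa using h3
    rw [pow_add, Module.End.mul_apply]
    have := k1 a ⟨_, h4⟩
    rw [ha] at this
    simpa using this

theorem nc_ext {V : Type} [AddCommGroup V] [Module (ZMod 2) V] {d : ℕ} (b : Fin d → V)
    (hb : Submodule.span (ZMod 2) (Set.range b) = ⊤) (g h : Module.End (ZMod 2) V)
    (hg : ∀ i, g (b i) = h (b i)) : g = h :=
  LinearMap.ext_on_range hb hg

/-- cyclic case -/
theorem nc_cyclic {V : Type} [AddCommGroup V] [Module (ZMod 2) V]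
    (f : Module.End (ZMod 2) V) (v : V) (d : ℕ) (hd : 0 < d)
    (B : Module.Basis (Fin d) (ZMod 2) V) (hB : ∀ i : Fin d, B i = (f ^ (i : ℕ)) v) :
    ∃ E : Module.End (ZMod 2) V, E * E = E ∧ IsNilpotent (f - E) := by
  have z2 : ∀ c : ZMod 2, c = 0 ∨ c = 1 := by decide
  have two : ∀ x : V, x + x = 0 := by
    intro x
    rw [← two_smul (ZMod 2) x, show (2 : ZMod 2) = 0 from rfl, zero_smul]
  have fs : ∀ j, f ((f ^ j) v) = (f ^ (j + 1)) v := by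
    intro j; rw [pow_succ', Module.End.mul_apply]
  obtain ⟨m, rfl⟩ : ∃ m, d = m + 1 := ⟨d - 1, by omega⟩
  have co : ∀ (i : Fin (m+1)) (j : ℕ), j < m + 1 → B.coord i ((f ^ j) v) = if j = i then 1 else 0 := by
    intro i j hj
    have := hB ⟨j, hj⟩
    simp only at this
    rw [← this, B.coord_apply, B.repr_self, Finsupp.single_apply]
    simp [Fin.ext_iff]
  rcases z2 (B.coord (Fin.last m) ((f ^ (m + 1)) v)) with h0 | h1
  · -- trace zero
    by_cases hz : (f ^ (m + 1)) v = 0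
    · refine ⟨0, by simp, m + 1, ?_⟩
      rw [sub_zero]
      refine B.ext fun i => ?_
      rw [hB, ← Module.End.mul_apply, ← pow_add, add_comm, pow_add, Module.End.mul_apply, hz]
      simp
    match m, B, hB, co, h0, hz with
    | 0, B, hB, co, h0, hz =>
      exfalso
      apply hz
      have : B.repr ((f ^ (0 + 1)) v) = 0 := by
        ext i
        have : i = Fin.last 0 := by ext; simp
        rw [this]; exact h0
      simpa using this
    | 1, B, hB, co, h0, hz =>
      have hv : (f ^ 2) v = v := by
        rcases z2 (B.coord 0 ((f ^ 2) v)) with h | h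
        · exfalso
          apply hz
          apply B.ext_elem
          intro i
          fin_cases i
          · simpa using h
          · simpa using h0
        · apply B.ext_elem
          intro i
          have c0 := co 0 0 (by omega)
          have c1 := co 1 0 (by omega)
          fin_cases i
          · simp at c0 h ⊢; rw [h, c0]
          · have h0' : B.coord 1 ((f ^ 2) v) = 0 := h0
            simp at c1 h0' ⊢; rw [h0', c1]
      have hf2 : f ^ 2 = 1 := by
        refine B.ext fun i => ?_
        rw [hB, ← Module.End.mul_apply, ← pow_add, add_comm, pow_add, Module.End.mul_apply, hv]
        simp
      refine ⟨1, by simp, 2, ?_⟩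
      have : (f - 1) ^ 2 = f ^ 2 - f - f + 1 := by noncomm_ring
      rw [this, hf2]
      ext x
      have h1 := two x
      have h2 := two (f x)
      simp only [LinearMap.add_apply, LinearMap.sub_apply, Module.End.one_apply, LinearMap.zero_apply]
      rw [show x - f x - f x + x = (x + x) - (f x + f x) by abel, h1, h2, sub_zero]
    | m + 2, B, hB, co, h0, hz =>
      set φ := B.coord (Fin.last (m + 2)) with hφ
      set ψ := B.coord (⟨m + 1, by omega⟩ : Fin (m + 3)) with hψ
      have cφ : ∀ j, j < m + 3 → φ ((f ^ j) v) = if j = m + 2 then 1 else 0 := fun j hj => co _ j hj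
      have cψ : ∀ j, j < m + 3 → ψ ((f ^ j) v) = if j = m + 1 then 1 else 0 := fun j hj => co _ j hj
      obtain ⟨ε, hε⟩ : ∃ ε : ZMod 2, ε = 1 + ψ ((f ^ (m + 3)) v) := ⟨_, rfl⟩
      obtain ⟨t, ht⟩ : ∃ t, t = (f ^ (m + 1)) v + ε • (f ^ m) v := ⟨_, rfl⟩
      obtain ⟨s, hs⟩ : ∃ s, s = (f ^ (m + 3)) v + (f ^ (m + 2)) v + ε • (f ^ (m + 1)) v + t := ⟨_, rfl⟩
      have p1 : φ t = 0 := by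
        rw [ht, map_add, map_smul, cφ _ (by omega), cφ _ (by omega)]; simp
      have p2 : ψ t = 1 := by
        rw [ht, map_add, map_smul, cψ _ (by omega), cψ _ (by omega)]; simp
      have p3 : φ s = 1 := by
        rw [hs, map_add, map_add, map_add, map_smul, h0, p1, cφ _ (by omega), cφ _ (by omega)]; simp
      have p4 : ψ s = 0 := by
        rw [hs, map_add, map_add, map_add, map_smul, p2, cψ (m + 2) (by omega), cψ (m + 1) (by omega), hε]
        generalize ψ ((f ^ (m + 3)) v) = c
        rw [if_neg (by omega), if_pos rfl]
        clear * -
        revert c; decide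
      let E : Module.End (ZMod 2) V := φ.smulRight s + ψ.smulRight t
      have hE : ∀ x, E x = φ x • s + ψ x • t := fun x => rfl
      refine ⟨E, ?_, m + 3, ?_⟩
      · ext x
        rw [Module.End.mul_apply, hE (E x), hE x]
        simp only [map_add, map_smul, p1, p2, p3, p4]
        simp
      · have n1 : ∀ j, j ≤ m + 1 → ((f - E) ^ j) v = (f ^ j) v := by
          intro j
          induction j with
          | zero => intro _; simp
          | succ j ih =>
            intro hj
            rw [pow_succ', Module.End.mul_apply, ih (by omega), LinearMap.sub_apply, hE, fs,
              cφ _ (by omega), cψ _ (by omega), if_neg (by omega), if_neg (by omega)]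
            simp
        have n2 : ((f - E) ^ (m + 2)) v = (f ^ (m + 2)) v - t := by
          rw [pow_succ', Module.End.mul_apply, n1 _ le_rfl, LinearMap.sub_apply, hE, fs,
              cφ _ (by omega), cψ _ (by omega), if_neg (by omega), if_pos rfl]
          simp
        have ft : f t = (f ^ (m + 2)) v + ε • (f ^ (m + 1)) v := by
          rw [ht, map_add, map_smul, fs, fs]
        have n3 : ((f - E) ^ (m + 3)) v = 0 := by
          rw [pow_succ', Module.End.mul_apply, n2, LinearMap.sub_apply, hE, map_sub, map_sub, map_sub, fs,
              cφ _ (by omega), cψ _ (by omega), if_pos rfl, if_neg (by omega), p1, p2, ft, hs]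
          simp only [sub_zero, one_smul, zero_sub, neg_smul]
          have q1 := two ((f ^ (m + 2)) v)
          have q2 := two (ε • (f ^ (m + 1)) v)
          have : ∀ a b c t : V, b + b = 0 → c + c = 0 → a - (b + c) - (a + b + c + t + -t) = 0 := by
            intro a b c t hb hc
            rw [show a - (b + c) - (a + b + c + t + -t) = - (b + b) - (c + c) by abel, hb, hc]
            simp
          exact this _ _ _ _ q1 q2
        have n4 : ∀ j, ((f - E) ^ (m + 3)) (((f - E) ^ j) v) = 0 := by
          intro j
          rw [← Module.End.mul_apply, ← pow_add, add_comm, pow_add, Module.End.mul_apply, n3, map_zero]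
        refine B.ext fun i => ?_
        rw [hB, LinearMap.zero_apply]
        by_cases hi : (i : ℕ) ≤ m + 1
        · rw [← n1 _ hi, n4]
        · have : (i : ℕ) = m + 2 := by omega
          rw [this, show (f ^ (m + 2)) v = ((f - E) ^ (m + 2)) v + t by rw [n2]; abel, ht,
            ← n1 _ le_rfl, ← n1 m (by omega)]
          simp only [map_add, map_smul, n4]
          simp
  · -- trace one
    set φ := B.coord (Fin.last m) with hφ
    let E : Module.End (ZMod 2) V := φ.smulRight ((f ^ (m + 1)) v)
    have hE : ∀ x, E x = φ x • (f ^ (m + 1)) v := fun x => rfl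
    refine ⟨E, ?_, m + 1, ?_⟩
    · ext x
      rw [Module.End.mul_apply, hE (E x), hE x]
      simp [h1]
    · have n1 : ∀ j, j ≤ m → ((f - E) ^ j) v = (f ^ j) v := by
        intro j
        induction j with
        | zero => intro _; simp
        | succ j ih =>
          intro hj
          rw [pow_succ', Module.End.mul_apply, ih (by omega), LinearMap.sub_apply, hE, fs,
            co _ _ (by omega), if_neg (by simp; omega)]
          simp
      have n3 : ((f - E) ^ (m + 1)) v = 0 := by
        rw [pow_succ', Module.End.mul_apply, n1 _ le_rfl, LinearMap.sub_apply, hE, fs,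
            co _ _ (by omega), if_pos (by simp)]
        simp
      refine B.ext fun i => ?_
      rw [hB, ← n1 _ (by omega), ← Module.End.mul_apply, ← pow_add, add_comm, pow_add,
        Module.End.mul_apply, n3]
      simp

theorem nc_main (d : ℕ) : ∀ {V : Type} [AddCommGroup V] [Module (ZMod 2) V]
    [FiniteDimensional (ZMod 2) V], Module.finrank (ZMod 2) V = d →
    ∀ f : Module.End (ZMod 2) V,
    ∃ E : Module.End (ZMod 2) V, E * E = E ∧ IsNilpotent (f - E) := by
  induction d using Nat.strong_induction_on with
  | _ d ih =>
  intro V _ _ _ hV f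
  rcases Nat.eq_zero_or_pos d with h0 | hd
  · have : Subsingleton V := by
      rw [h0] at hV
      exact Module.finrank_zero_iff.mp hV
    exact ⟨0, by simp, 1, LinearMap.ext fun x => Subsingleton.elim _ _⟩
  have : Nontrivial V := Module.nontrivial_of_finrank_pos (R := ZMod 2) (by omega)
  obtain ⟨v, hv⟩ := exists_ne (0 : V)
  let b : Fin d → V := fun i => (f ^ (i : ℕ)) v
  let W := Submodule.span (ZMod 2) (Set.range b)
  have hbW : ∀ j, j < d → (f ^ j) v ∈ W := fun j hj => Submodule.subset_span ⟨⟨j, hj⟩, rfl⟩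
  have hdW : (f ^ d) v ∈ W := by
    have hc := LinearMap.aeval_self_charpoly f
    have hm := LinearMap.charpoly_monic f
    have hn := LinearMap.charpoly_natDegree f
    rw [hm.as_sum, hn, hV] at hc
    have := LinearMap.congr_fun hc v
    simp only [map_add, map_sum, map_mul, map_pow, Polynomial.aeval_X, Polynomial.aeval_C,
      LinearMap.add_apply, LinearMap.zero_apply, LinearMap.sum_apply, Module.End.mul_apply,
      Module.algebraMap_end_apply] at this
    rw [eq_neg_of_add_eq_zero_left this]
    refine W.neg_mem (W.sum_mem fun i hi => W.smul_mem _ (hbW i (Finset.mem_range.mp hi)))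
  have hW : ∀ w ∈ W, f w ∈ W := by
    intro w hw
    have : W ≤ W.comap f := by
      refine Submodule.span_le.mpr ?_
      rintro _ ⟨i, rfl⟩
      change f ((f ^ (i : ℕ)) v) ∈ W
      rw [← Module.End.mul_apply, ← pow_succ']
      rcases Nat.lt_or_ge (i + 1 : ℕ) d with h | h
      · exact hbW _ h
      · have : (i : ℕ) + 1 = d := by omega
        rw [this]; exact hdW
    exact this hw
  by_cases hT : W = ⊤
  · let B := basisOfTopLeSpanOfCardEqFinrank b (by rw [← hT]) (by simp [hV])
    exact nc_cyclic f v d hd B (fun i => by simp [B, b])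
  · have hv' : v ∈ W := by simpa using hbW 0 hd
    have hr := W.finrank_quotient_add_finrank
    have hlt := Submodule.finrank_lt hT
    have hpos : 0 < Module.finrank (ZMod 2) W := by
      have : Nontrivial W := ⟨⟨v, hv'⟩, 0, fun h => hv (congrArg Subtype.val h)⟩
      exact Module.finrank_pos
    exact nc_glue f W hW (ih _ (by omega) rfl) (ih _ (by omega) rfl)

theorem stmt4 (k n : ℕ) (hk : 1 ≤ k) (hn : 2 ≤ n) (hodd : Odd k) :
    ∀ M : Matrix (Fin n) (Fin n) (ZMod 2), ∃ A B : Matrix (Fin n) (Fin n) (ZMod 2),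
      M = A ^ k + B ^ k := by
  intro M
  have key : ∃ E : Matrix (Fin n) (Fin n) (ZMod 2), E * E = E ∧ IsNilpotent (M - 1 - E) := by
    obtain ⟨E, hE, r, hr⟩ := nc_main _ rfl (Matrix.toLinAlgEquiv' (M - 1))
    refine ⟨Matrix.toLinAlgEquiv'.symm E, by rw [← map_mul, hE], r, ?_⟩
    apply Matrix.toLinAlgEquiv'.injective
    rw [map_pow, map_sub, AlgEquiv.apply_symm_apply, hr, map_zero]
  obtain ⟨E, hE, r, hr⟩ := key
  set N := M - 1 - E with hN
  have hU : (N + 1) ^ (2 ^ r) = 1 := by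
    have : CharP (Matrix (Fin n) (Fin n) (ZMod 2)) 2 := by
      have : Nonempty (Fin n) := ⟨⟨0, by omega⟩⟩
      infer_instance
    have h := (Commute.one_right N)
    rw [add_pow_char_pow_of_commute 2 _ h, one_pow, pow_eq_zero_of_le (Nat.lt_two_pow_self).le hr, zero_add]
  have hcop : Nat.Coprime k (2 ^ r) := Nat.Coprime.pow_right r (Nat.coprime_two_right.mpr hodd)
  refine ⟨E, (N + 1) ^ (k ^ (Nat.totient (2 ^ r) - 1)), ?_⟩
  have hEk : E ^ k = E := (show IsIdempotentElem E from hE).pow_eq (by omega)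
  have ht : 0 < Nat.totient (2 ^ r) := Nat.totient_pos.mpr (by positivity)
  have hmod := Nat.ModEq.pow_totient hcop
  rw [hEk, ← pow_mul, ← pow_succ, Nat.sub_add_cancel ht]
  have : (N + 1) ^ (k ^ Nat.totient (2 ^ r)) = (N + 1) ^ 1 :=
    pow_eq_pow_of_modEq hmod hU
  rw [this, pow_one, hN]
  abel
end

section
/- If q ≥ 3, then every matrix in M_n(𝔽_q) is a sum of two matrices that are both invertible and cyclic. -/
/-- A matrix `A` is cyclic if there is a vector `v` such that
`v, A v, …, A^(n-1) v` span (equivalently, form a basis of) `F^n`. -/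
def IsCyclicMatrix {n : ℕ} {F : Type*} [Field F]
    (A : Matrix (Fin n) (Fin n) F) : Prop :=
  ∃ v : Fin n → F,
    Submodule.span F (Set.range fun i : Fin n => (A ^ (i : ℕ)).mulVec v) = ⊤

theorem aux_avoid {F : Type*} [Field F] [Fintype F] (hF : 3 ≤ Fintype.card F) (a b c d : F)
    (ha : a ≠ 0) (hc : c ≠ 0) : ∃ x : F, b + x * a ≠ 0 ∧ d - x * c ≠ 0 := by
  classical
  have : ∃ x : F, x ∉ ({-b / a, d / c} : Finset F) := by
    by_contra h
    push Not at h
    have h1 : (Finset.univ : Finset F) ⊆ {-b / a, d / c} := fun x _ => h x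
    have h2 := Finset.card_le_card h1
    have h3 : ({-b / a, d / c} : Finset F).card ≤ 2 := Finset.card_le_two
    rw [Finset.card_univ] at h2
    omega
  obtain ⟨x, hx⟩ := this
  simp only [Finset.mem_insert, Finset.mem_singleton, not_or] at hx
  refine ⟨x, fun h => hx.1 ?_, fun h => hx.2 ?_⟩
  · field_simp
    linear_combination h
  · field_simp
    linear_combination -h

theorem aux_det {F : Type*} [Field F] {n : ℕ} (A : Matrix (Fin (n+1)) (Fin (n+1)) F)
    (d : Fin n → F) (x : F) :
    (A + Matrix.diagonal (Fin.cons x d : Fin (n+1) → F)).det =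
      (A + Matrix.diagonal (Fin.cons 0 d : Fin (n+1) → F)).det +
        x * (A.submatrix Fin.succ Fin.succ + Matrix.diagonal d).det := by
  have key : ∀ (y : F) (f : Fin n → Fin (n+1)),
      (A + Matrix.diagonal (Fin.cons y d : Fin (n+1) → F)).submatrix Fin.succ f =
      (A + Matrix.diagonal (Fin.cons 0 d : Fin (n+1) → F)).submatrix Fin.succ f := by
    intro y f
    ext i j
    simp [Matrix.diagonal_apply]
  have key2 : (A + Matrix.diagonal (Fin.cons 0 d : Fin (n+1) → F)).submatrix Fin.succ Fin.succ
      = A.submatrix Fin.succ Fin.succ + Matrix.diagonal d := by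
    ext i j
    simp [Matrix.diagonal_apply]
  rw [Matrix.det_succ_row_zero, Matrix.det_succ_row_zero
    (A + Matrix.diagonal (Fin.cons 0 d : Fin (n+1) → F))]
  simp only [key x]
  rw [Fin.sum_univ_succ, Fin.sum_univ_succ]
  have h0 : ∀ (y : F) (j : Fin n),
      (A + Matrix.diagonal (Fin.cons y d : Fin (n+1) → F)) 0 j.succ = A 0 j.succ := by
    intro y j
    simp [Matrix.diagonal_apply, (Fin.succ_ne_zero j).symm]
  simp only [h0]
  simp only [Fin.succAbove_zero, key2]
  simp only [Matrix.add_apply, Matrix.diagonal_apply_eq, Fin.cons_zero, Fin.val_zero, pow_zero]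
  ring

theorem aux_diag_s6 {F : Type*} [Field F] [Fintype F] (hF : 3 ≤ Fintype.card F) :
    ∀ (n : ℕ) (A B : Matrix (Fin n) (Fin n) F), ∃ d : Fin n → F,
      (A + Matrix.diagonal d).det ≠ 0 ∧ (B + Matrix.diagonal (-d)).det ≠ 0 := by
  intro n
  induction n with
  | zero => intro A B; exact ⟨0, by simp, by simp⟩
  | succ n ih =>
    intro A B
    obtain ⟨d, h1, h2⟩ := ih (A.submatrix Fin.succ Fin.succ) (B.submatrix Fin.succ Fin.succ)
    obtain ⟨x, hx1, hx2⟩ := aux_avoid hF _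
      ((A + Matrix.diagonal (Fin.cons 0 d : Fin (n+1) → F)).det) _
      ((B + Matrix.diagonal (Fin.cons 0 (-d) : Fin (n+1) → F)).det) h1 h2
    refine ⟨(Fin.cons x d : Fin (n+1) → F), ?_, ?_⟩
    · rw [aux_det]; exact hx1
    · have : -(Fin.cons x d : Fin (n+1) → F) = (Fin.cons (-x) (-d) : Fin (n+1) → F) := by
        ext i
        refine Fin.cases ?_ (fun j => ?_) i <;> simp
      rw [this, aux_det]
      intro h
      apply hx2
      linear_combination h

theorem aux_cyclic_s6 {F : Type*} [Field F] {n : ℕ} (hn : 0 < n) (A : Matrix (Fin n) (Fin n) F)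
    (σ : Equiv.Perm (Fin n))
    (h0 : ∀ i j : Fin n, (j : ℕ) + 1 < i → A (σ i) (σ j) = 0)
    (h1 : ∀ i j : Fin n, (j : ℕ) + 1 = i → A (σ i) (σ j) ≠ 0) : IsCyclicMatrix A := by
  set v : Fin n → F := Pi.single (σ ⟨0, hn⟩) 1 with hv
  let S : ℕ → Submodule F (Fin n → F) := fun k =>
    Submodule.span F ((fun i : ℕ => (A ^ i).mulVec v) '' Set.Iic k)
  have mono : ∀ j k, j ≤ k → S j ≤ S k := fun j k h =>
    Submodule.span_mono (Set.image_mono (Set.Iic_subset_Iic.2 h))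
  have step : ∀ k, ∀ w ∈ S k, A.mulVec w ∈ S (k+1) := by
    intro k w hw
    have : S k ≤ (S (k+1)).comap A.mulVecLin := by
      refine Submodule.span_le.2 ?_
      rintro _ ⟨i, hi, rfl⟩
      refine Submodule.subset_span ⟨i+1, by simpa using hi, ?_⟩
      simp [pow_succ']
    exact this hw
  have main : ∀ k, ∀ hk : k < n, (Pi.single (σ ⟨k, hk⟩) 1 : Fin n → F) ∈ S k := by
    intro k
    induction k using Nat.strong_induction_on with
    | _ k ih =>
      intro hk
      rcases k with _ | k
      · exact Submodule.subset_span ⟨0, by simp, by simp only [pow_zero, Matrix.one_mulVec, hv]⟩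
      · have hk' : k < n := by omega
        have e := step k _ (ih k (by omega) hk')
        have expand : A.mulVec (Pi.single (σ ⟨k, hk'⟩) 1) =
            ∑ i : Fin n, A (σ i) (σ ⟨k, hk'⟩) • (Pi.single (σ i) 1 : Fin n → F) := by
          rw [Equiv.sum_comp σ (fun i => A i (σ ⟨k, hk'⟩) • (Pi.single i 1 : Fin n → F))]
          ext i
          simp [Finset.sum_apply, Pi.single_apply]
        rw [expand, ← Finset.add_sum_erase _ _ (Finset.mem_univ (⟨k+1, hk⟩ : Fin n))] at e
        have rest : ∑ i ∈ Finset.univ.erase (⟨k+1, hk⟩ : Fin n),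
            A (σ i) (σ ⟨k, hk'⟩) • (Pi.single (σ i) 1 : Fin n → F) ∈ S (k+1) := by
          refine Submodule.sum_mem _ fun i hi => ?_
          have hne : (i : ℕ) ≠ k+1 := fun h => (Finset.ne_of_mem_erase hi) (Fin.ext h)
          rcases lt_or_gt_of_ne hne with h | h
          · exact Submodule.smul_mem _ _ (mono _ _ h.le (ih i h i.2))
          · rw [h0 i ⟨k, hk'⟩ h, zero_smul]; exact Submodule.zero_mem _
        have := (Submodule.add_mem_iff_left _ rest).1 e
        exact (Submodule.smul_mem_iff _ (h1 ⟨k+1, hk⟩ ⟨k, hk'⟩ rfl)).1 this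
  refine ⟨v, ?_⟩
  rw [eq_top_iff]
  have sub : ∀ k, k < n → S k ≤
      Submodule.span F (Set.range fun i : Fin n => (A ^ (i : ℕ)).mulVec v) := by
    intro k hk
    refine Submodule.span_mono ?_
    rintro _ ⟨i, hi, rfl⟩
    exact ⟨⟨i, lt_of_le_of_lt hi hk⟩, rfl⟩
  intro w _
  have hw : w = ∑ i : Fin n, w (σ i) • (Pi.single (σ i) 1 : Fin n → F) := by
    rw [Equiv.sum_comp σ (fun i => w i • (Pi.single i 1 : Fin n → F))]
    ext i
    simp [Finset.sum_apply, Pi.single_apply]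
  rw [hw]
  exact Submodule.sum_mem _ fun i _ => Submodule.smul_mem _ _ (sub i i.2 (main i i.2))

theorem stmt6 (F : Type*) [Field F] [Fintype F] (hF : 3 ≤ Fintype.card F)
    (n : ℕ) (hn : 2 ≤ n) :
    ∀ M : Matrix (Fin n) (Fin n) F, ∃ A B : Matrix (Fin n) (Fin n) F,
      IsUnit A ∧ IsUnit B ∧ IsCyclicMatrix A ∧ IsCyclicMatrix B ∧ M = A + B := by
  intro M
  let A0 : Matrix (Fin n) (Fin n) F := Matrix.of fun i j =>
    if (i : ℕ) < j then (if (i : ℕ) + 1 = j then M i j - 1 else M i j)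
    else (if (j : ℕ) + 1 = i then 1 else 0)
  obtain ⟨d, h1, h2⟩ := aux_diag_s6 hF n A0 (M - A0)
  refine ⟨A0 + Matrix.diagonal d, M - A0 + Matrix.diagonal (-d), ?_, ?_, ?_, ?_, ?_⟩
  · exact (Matrix.isUnit_iff_isUnit_det _).2 h1.isUnit
  · exact (Matrix.isUnit_iff_isUnit_det _).2 h2.isUnit
  · refine aux_cyclic_s6 (by omega) _ (Equiv.refl _) (fun i j h => ?_) (fun i j h => ?_)
    · have hne : i ≠ j := fun e => by subst e; omega
      simp [A0, Matrix.diagonal_apply, hne, show ¬ (i : ℕ) < j by omega,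
        show ¬ (j : ℕ) + 1 = i by omega, -Fin.val_fin_lt]
    · have hne : i ≠ j := fun e => by subst e; omega
      simp [A0, Matrix.diagonal_apply, hne, show ¬ (i : ℕ) < j by omega, h, -Fin.val_fin_lt]
  · refine aux_cyclic_s6 (by omega) _ Fin.revPerm (fun i j h => ?_) (fun i j h => ?_)
    all_goals
      have e1 : ((Fin.revPerm i : Fin n) : ℕ) = n - (i + 1) := by simp [Fin.val_rev]
      have e2 : ((Fin.revPerm j : Fin n) : ℕ) = n - (j + 1) := by simp [Fin.val_rev]
      have hi := i.2
      have hj := j.2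
      generalize Fin.revPerm i = a at *
      generalize Fin.revPerm j = b at *
      have hne : a ≠ b := fun e => by subst e; omega
    · simp [A0, Matrix.diagonal_apply, hne, show (a : ℕ) < b by omega,
        show ¬ (a : ℕ) + 1 = b by omega, -Fin.val_fin_lt]
    · simp [A0, Matrix.diagonal_apply, hne, show (a : ℕ) < b by omega,
        show (a : ℕ) + 1 = b by omega, -Fin.val_fin_lt]
  · ext i j
    by_cases h : i = j
    · subst h; simp; ring
    · simp [Matrix.diagonal_apply, h]
end

section
/- If q ≥ 3, then every matrix in M_n(𝔽_q) is a sum of two matrices that are both invertible and semisimple. -/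
/-- A matrix over a field is semisimple if its minimal polynomial is squarefree. -/
def IsSemisimpleMatrix {n : ℕ} {F : Type*} [Field F]
    (A : Matrix (Fin n) (Fin n) F) : Prop :=
  Squarefree (minpoly F A)

open Polynomial

def GoodEnd {K V : Type*} [Field K] [AddCommGroup V] [Module K V] (A : Module.End K V) : Prop :=
  ∃ p : K[X], Squarefree p ∧ p.eval 0 ≠ 0 ∧ aeval A p = 0

def SplitEnd {K V : Type*} [Field K] [AddCommGroup V] [Module K V] (f : Module.End K V) : Prop :=
  ∃ A B : Module.End K V, GoodEnd A ∧ GoodEnd B ∧ f = A + B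

theorem exists_irred (F : Type*) [Field F] [Fintype F] (m : ℕ) (hm : m ≠ 0) :
    ∃ g : F[X], g.Monic ∧ Irreducible g ∧ g.natDegree = m := by
  have : NeZero m := ⟨hm⟩
  obtain ⟨p, hp⟩ := CharP.exists F
  have : Fact p.Prime := ⟨CharP.char_is_prime F p⟩
  obtain ⟨α, hα⟩ := Field.exists_primitive_element F (FiniteField.Extension F p m)
  have hi : IsIntegral F α := IsIntegral.of_finite F α
  refine ⟨minpoly F α, minpoly.monic hi, minpoly.irreducible hi, ?_⟩
  rw [← IntermediateField.adjoin.finrank hi, hα, IntermediateField.finrank_top',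
    FiniteField.finrank_extension]

theorem sq_quad {K : Type*} [Field K] (t D : K) (h : t ^ 2 - 4 * D ≠ 0) :
    Squarefree (X ^ 2 - C t * X + C D : K[X]) := by
  apply Polynomial.Separable.squarefree
  refine ⟨C (-4 / (t^2-4*D)), C (1 / (t^2-4*D)) * (2 * X - C t), ?_⟩
  have h1 : derivative (X ^ 2 - C t * X + C D : K[X]) = 2 * X - C t := by
    rw [derivative_add, derivative_sub, derivative_X_sq, derivative_C_mul, derivative_X, derivative_C, map_ofNat C 2]
    ring
  rw [h1]
  have h2 : (C (-4 / (t^2-4*D)) : K[X]) = -4 * C (1 / (t^2-4*D)) := by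
    rw [show (-4 : K[X]) = C (-4) by rw [map_neg, map_ofNat C 4], ← C_mul]; congr 1; ring
  rw [h2]
  have h3 : (C (1 / (t^2-4*D)) : K[X]) * (C t ^ 2 - 4 * C D) = 1 := by
    rw [show (C t ^ 2 - 4 * C D : K[X]) = C (t^2 - 4 * D) by
      rw [C_sub, C_mul, C_pow, map_ofNat C 4], ← C_mul, one_div, inv_mul_cancel₀ h, C_1]
  linear_combination h3

theorem good_quad {K V : Type*} [Field K] [AddCommGroup V] [Module K V]
    (b : Module.Basis (Fin 2) K V) (M : Matrix (Fin 2) (Fin 2) K) (hd : M.det ≠ 0)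
    (h : M.trace ^ 2 - 4 * M.det ≠ 0) : GoodEnd (Matrix.toLin b b M) := by
  refine ⟨_, sq_quad _ _ h, by simpa using hd, ?_⟩
  rw [← Matrix.charpoly_fin_two]
  have : aeval (Matrix.toLinAlgEquiv b M) M.charpoly = Matrix.toLinAlgEquiv b (aeval M M.charpoly) :=
    aeval_algHom_apply (Matrix.toLinAlgEquiv b).toAlgHom M _
  rw [Matrix.aeval_self_charpoly, map_zero] at this
  exact this

/-- two-dimensional numeric statement -/
theorem num_two (F : Type*) [Field F] [Fintype F] (hF : 3 ≤ Fintype.card F) (D t : F) :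
    ∃ M N : Matrix (Fin 2) (Fin 2) F, M + N = !![0, D; 1, t] ∧ M.det ≠ 0 ∧ N.det ≠ 0 ∧
      M.trace ^ 2 - 4 * M.det ≠ 0 ∧ N.trace ^ 2 - 4 * N.det ≠ 0 := by
  classical
  have avoid : ∀ S : Finset F, S.card < Fintype.card F → ∃ x, x ∉ S := by
    intro S hS
    by_contra! hc
    exact absurd (Finset.card_le_card (fun x _ => hc x : Finset.univ ⊆ S)) (by simpa using hS)
  obtain ⟨α, hα⟩ := avoid {0, 1} (lt_of_le_of_lt Finset.card_le_two (by omega))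
  simp only [Finset.mem_insert, Finset.mem_singleton, not_or] at hα
  obtain ⟨ha0, ha1⟩ := hα
  have hb0 : 1 - α ≠ 0 := fun h => ha1 (by linear_combination -h)
  by_cases h2 : (2 : F) = 0
  · obtain ⟨u1, hu1⟩ := avoid {0, t} (lt_of_le_of_lt Finset.card_le_two (by omega))
    obtain ⟨u0, hu0⟩ := avoid {0, D} (lt_of_le_of_lt Finset.card_le_two (by omega))
    simp only [Finset.mem_insert, Finset.mem_singleton, not_or] at hu1 hu0
    have h4 : (4 : F) = 0 := by linear_combination 2 * h2
    refine ⟨!![0, u0; α, u1], !![0, D - u0; 1 - α, t - u1], ?_, ?_, ?_, ?_, ?_⟩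
    · ext i j; fin_cases i <;> fin_cases j <;> simp
    · simp [Matrix.det_fin_two, ha0, hu0.1]
    · simp [Matrix.det_fin_two, hb0, sub_ne_zero, Ne.symm hu0.2]
    · simp [Matrix.trace_fin_two, h4, hu1.1]
    · simp [Matrix.trace_fin_two, h4, sub_ne_zero, Ne.symm hu1.2]
  have h4 : (4 : F) ≠ 0 := by
    rw [show (4 : F) = 2 * 2 by norm_num]; exact mul_ne_zero h2 h2
  by_cases hc : Fintype.card F = 3
  · have h3 : (3 : F) = 0 := by
      have := Nat.cast_card_eq_zero F
      rw [hc] at this; exact_mod_cast this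
    have h11 : (1 : F) ≠ -1 := fun h => h2 (by linear_combination h)
    have hU : ({0, 1, -1} : Finset F) = Finset.univ := by
      apply Finset.eq_univ_of_card
      rw [hc, Finset.card_eq_three]
      exact ⟨0, 1, -1, by simp, by simp, h11, rfl⟩
    have tri : ∀ x : F, x = 0 ∨ x = 1 ∨ x = -1 := by
      intro x
      have := Finset.mem_univ x
      rw [← hU] at this
      simpa using this
    have key : ∀ a b c d a' b' c' d' : F, a + a' = 0 → b + b' = D → c + c' = 1 → d + d' = t →
       (a * d - b * c) ≠ 0 → (a' * d' - b' * c') ≠ 0 → (a + d)^2 - 4 * (a * d - b * c) ≠ 0 →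
       (a' + d')^2 - 4 * (a' * d' - b' * c') ≠ 0 → ∃ M N : Matrix (Fin 2) (Fin 2) F, M + N = !![0, D; 1, t] ∧ M.det ≠ 0 ∧ N.det ≠ 0 ∧
      M.trace ^ 2 - 4 * M.det ≠ 0 ∧ N.trace ^ 2 - 4 * N.det ≠ 0 := by
      intro a b c d a' b' c' d' e1 e2 e3 e4 f1 f2 f3 f4
      refine ⟨!![a, b; c, d], !![a', b'; c', d'], ?_, ?_, ?_, ?_, ?_⟩
      · ext i j; fin_cases i <;> fin_cases j <;> simp [*]
      all_goals simpa [Matrix.det_fin_two, Matrix.trace_fin_two]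
    rcases tri t with rfl | rfl | rfl <;> rcases tri D with rfl | rfl | rfl
    · apply key 0 1 (-1) 0 0 (-1) (-1) 0 <;> grind
    · apply key 0 (-1) (-1) 0 0 (-1) (-1) 0 <;> grind
    · apply key 0 1 (-1) 0 0 1 (-1) 0 <;> grind
    · apply key 0 1 (-1) 0 0 (-1) (-1) 1 <;> grind
    · apply key 0 (-1) (-1) 0 0 (-1) (-1) 1 <;> grind
    · apply key 1 0 0 (-1) (-1) (-1) 1 (-1) <;> grind
    · apply key 0 1 (-1) 0 0 (-1) (-1) (-1) <;> grind
    · apply key 0 (-1) (-1) 0 0 (-1) (-1) (-1) <;> grind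
    · apply key 1 0 (-1) (-1) (-1) (-1) (-1) 0 <;> grind
  · have h5 : ∃ u0 : F, u0 ∉ ({0, D, 0, D + t ^ 2 / (4 * (1 - α))} : Finset F) := by
      apply avoid
      have := @Finset.card_le_four F _ 0 D 0 (D + t ^ 2 / (4 * (1 - α)))
      refine lt_of_le_of_ne (by omega) ?_
      intro h
      have hl : Fintype.card F = 4 := by omega
      have := Nat.cast_card_eq_zero F
      rw [hl] at this; exact h4 (by exact_mod_cast this)
    obtain ⟨u0, hu⟩ := h5
    simp only [Finset.mem_insert, Finset.mem_singleton, not_or] at hu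
    refine ⟨!![0, u0; α, 0], !![0, D - u0; 1 - α, t], ?_, ?_, ?_, ?_, ?_⟩
    · ext i j; fin_cases i <;> fin_cases j <;> simp
    · simp [Matrix.det_fin_two, ha0, hu.1]
    · simp [Matrix.det_fin_two, hb0, sub_ne_zero, Ne.symm hu.2.1]
    · simp [Matrix.trace_fin_two, Matrix.det_fin_two, h4, hu.1, ha0]
    · simp [Matrix.trace_fin_two, Matrix.det_fin_two]
      intro h
      apply hu.2.2.2
      field_simp
      linear_combination -h

theorem split_one {K V : Type*} [Field K] [Fintype K] (hF : 3 ≤ Fintype.card K) [AddCommGroup V] [Module K V]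
    (c : K) : SplitEnd (algebraMap K (Module.End K V) c) := by
  classical
  obtain ⟨a, ha⟩ : ∃ a : K, a ∉ ({0, c} : Finset K) := by
    by_contra! hc
    have := Finset.card_le_card (fun x _ => hc x : Finset.univ ⊆ ({0, c} : Finset K))
    have := @Finset.card_le_two K _ 0 c
    rw [Finset.card_univ] at *
    omega
  simp only [Finset.mem_insert, Finset.mem_singleton, not_or] at ha
  have good : ∀ x : K, x ≠ 0 → GoodEnd (algebraMap K (Module.End K V) x) := fun x hx =>
    ⟨X - C x, (irreducible_X_sub_C x).squarefree, by simpa using hx, by simp⟩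
  exact ⟨_, _, good a ha.1, good (c - a) (sub_ne_zero.2 (Ne.symm ha.2)), by rw [← map_add]; congr 1; ring⟩

theorem aeval_mod {K V : Type*} [Field K] [AddCommGroup V] [Module K V] (A A' : Module.End K V)
    (U W : Submodule K V) (h : ∀ u ∈ W, A u - A' u ∈ U) (hU : ∀ u ∈ U, A u ∈ U)
    (hW : ∀ u ∈ W, A' u ∈ W) (p : K[X]) (u : V) (hu : u ∈ W) :
    aeval A p u - aeval A' p u ∈ U := by
  have hWk : ∀ k : ℕ, (A' ^ k) u ∈ W := by
    intro k
    induction k with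
    | zero => simpa
    | succ k ih => rw [pow_succ', Module.End.mul_apply]; exact hW _ ih
  have hk : ∀ k : ℕ, (A ^ k) u - (A' ^ k) u ∈ U := by
    intro k
    induction k with
    | zero => simp
    | succ k ih =>
      rw [pow_succ', Module.End.mul_apply, pow_succ', Module.End.mul_apply]
      have := U.add_mem (hU _ ih) (h _ (hWk k))
      rw [map_sub] at this
      simpa using this
  induction p using Polynomial.induction_on' with
  | add p q hp hq =>
    simp only [map_add, LinearMap.add_apply]
    have := U.add_mem hp hq
    convert this using 1
    abel
  | monomial k c =>
    rw [aeval_monomial, aeval_monomial, Module.End.mul_apply, Module.End.mul_apply,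
      Module.algebraMap_end_apply, Module.algebraMap_end_apply, ← smul_sub]
    exact U.smul_mem _ (hk k)

theorem irred_scale {K : Type*} [Field K] (g : K[X]) (hg : Irreducible g) (γ : K) (hγ : γ ≠ 0) :
    Irreducible (g.comp (C γ * X)) := by
  let := invertibleOfNonzero hγ
  have h := (MulEquiv.irreducible_iff (algEquivCMulXAddC γ 0)).2 hg
  simpa [algEquivCMulXAddC_apply, comp_eq_aeval] using h

theorem good_of {K V : Type*} [Field K] [AddCommGroup V] [Module K V] (A : Module.End K V)
    (g : K[X]) (hg : Irreducible g) (hd : 2 ≤ g.natDegree) (γ a : K) (hγ : γ ≠ 0) (ha : a ≠ 0)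
    (h : aeval A ((X - C a) * g.comp (C γ * X)) = 0) : GoodEnd A := by
  have hi := irred_scale g hg γ hγ
  have hdeg : (g.comp (C γ * X)).natDegree = g.natDegree := by
    rw [natDegree_comp, natDegree_C_mul_X _ hγ, mul_one]
  refine ⟨_, ?_, ?_, h⟩
  · have hn : IsRelPrime (X - C a) (g.comp (C γ * X)) := by
      apply IsCoprime.isRelPrime
      refine ((irreducible_X_sub_C a).coprime_iff_not_dvd).2 ?_
      intro hdv
      have := (irreducible_X_sub_C a).associated_of_dvd hi hdv
      have := natDegree_eq_of_degree_eq (degree_eq_degree_of_associated this)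
      rw [hdeg, natDegree_X_sub_C] at this
      omega
    exact squarefree_mul_iff.2 ⟨hn, (irreducible_X_sub_C a).squarefree, hi.squarefree⟩
  · rw [eval_mul]
    refine mul_ne_zero (by simpa) ?_
    intro h0
    have := degree_eq_one_of_irreducible_of_root hi (x := 0) h0
    have := natDegree_eq_of_degree_eq_some (n := 1) (by simpa using this)
    omega

theorem split_cyc {K V : Type*} [Field K] [Fintype K] (hF : 3 ≤ Fintype.card K)
    [AddCommGroup V] [Module K V] (φ : Module.End K V) (m : ℕ) (hm : 2 ≤ m)
    (b : Module.Basis (Fin (m+1)) K V) (v : V) (hb : ∀ i, b i = (φ ^ (i : ℕ)) v) : SplitEnd φ := by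
  classical
  obtain ⟨g, hgm, hgi, hgd⟩ := exists_irred K m (by omega)
  have avoid : ∀ c : K, ∃ x : K, x ≠ 0 ∧ x ≠ c := by
    intro c
    by_contra! hc
    have h1 := Finset.card_le_card (fun x _ => by
      by_cases h : x = 0
      · simp [h]
      · simp [hc x h] : Finset.univ ⊆ ({0, c} : Finset K))
    have := @Finset.card_le_two K _ 0 c
    rw [Finset.card_univ] at *
    omega
  obtain ⟨α, hα0, hα1⟩ := avoid 1
  have hβ : 1 - α ≠ 0 := sub_ne_zero.2 (Ne.symm hα1)
  set l : V →ₗ[K] K := b.coord (Fin.last m) with hl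
  have hlb : ∀ i : ℕ, i < m → l ((φ ^ i) v) = 0 := by
    intro i hi
    have := hb ⟨i, by omega⟩
    simp only at this
    rw [← this, hl, Module.Basis.coord_apply, Module.Basis.repr_self, Finsupp.single_apply, if_neg]
    intro h
    simp [Fin.ext_iff] at h
    omega
  have hlm : l ((φ ^ m) v) = 1 := by
    have := hb (Fin.last m)
    simp only [Fin.val_last] at this
    rw [← this, hl, Module.Basis.coord_apply, Module.Basis.repr_self, Finsupp.single_apply, if_pos rfl]
  have hsum : ∀ Y : Module.End K V, aeval Y g v =
      ∑ i ∈ Finset.range m, g.coeff i • (Y ^ i) v + (Y ^ m) v := by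
    intro Y
    rw [aeval_eq_sum_range, hgd, Finset.sum_range_succ]
    have : g.coeff m = 1 := by rw [← hgd]; exact hgm
    rw [this]
    simp
  set w : V := aeval φ g v with hw
  have hlw : l w = 1 := by
    rw [hw, hsum, map_add, map_sum, hlm, Finset.sum_eq_zero, zero_add]
    intro i hi
    rw [map_smul, hlb i (Finset.mem_range.1 hi), smul_zero]
  obtain ⟨a, ha0, ha1⟩ := avoid (l (φ w))
  set T : Module.End K V := φ - (l ∘ₗ φ).smulRight w with hT
  have hTu : ∀ u, T u = φ u - l (φ u) • w := fun u => by simp [hT]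
  have hlT : ∀ u, l (T u) = 0 := fun u => by simp [hTu, hlw]
  have hTi : ∀ i, i < m → (T ^ i) v = (φ ^ i) v := by
    intro i
    induction i with
    | zero => simp
    | succ i ih =>
      intro hi
      have h2 := hlb (i+1) hi
      rw [pow_succ', Module.End.mul_apply] at h2
      rw [pow_succ', Module.End.mul_apply, ih (by omega), hTu, h2, zero_smul, sub_zero, pow_succ',
        Module.End.mul_apply]
  have hTm : (T ^ m) v = (φ ^ m) v - w := by
    obtain ⟨k, rfl⟩ : ∃ k, m = k + 1 := ⟨m - 1, by omega⟩
    have h2 := hlm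
    rw [pow_succ', Module.End.mul_apply] at h2
    rw [pow_succ', Module.End.mul_apply, hTi k (by omega), hTu, h2, one_smul, pow_succ',
        Module.End.mul_apply]
  have hgT : aeval T g v = 0 := by
    rw [hsum, hTm, Finset.sum_congr rfl (fun i hi => by rw [hTi i (Finset.mem_range.1 hi)]),
      ← add_sub_assoc, ← hsum, sub_self]
  have hgW : ∀ u, l u = 0 → aeval T g u = 0 := by
    intro u hu
    rw [← b.sum_repr u, Fin.sum_univ_castSucc]
    have : b.repr u (Fin.last m) = 0 := hu
    rw [this, zero_smul, add_zero, map_sum]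
    apply Finset.sum_eq_zero
    intro i _
    rw [map_smul, hb, Fin.val_castSucc, ← hTi i i.2, ← Module.End.mul_apply]
    have : aeval T g * T ^ (i : ℕ) = T ^ (i : ℕ) * aeval T g := by
      have h := congrArg (aeval T) (mul_comm g (X ^ (i : ℕ)))
      simpa using h
    rw [this, Module.End.mul_apply, hgT, map_zero, smul_zero]
  have hsc : ∀ γ : K, γ ≠ 0 → aeval (γ • T) (g.comp (C γ⁻¹ * X)) = aeval T g := by
    intro γ hγ
    rw [aeval_comp]
    congr 1
    simp [Algebra.algebraMap_eq_smul_one, smul_smul, hγ]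
  set A : Module.End K V := α • (T ∘ₗ (LinearMap.id - l.smulRight w)) +
    (l ∘ₗ φ ∘ₗ (LinearMap.id - l.smulRight w)).smulRight w + a • l.smulRight w with hA
  have hAW : ∀ u, l u = 0 → A u = α • T u + l (φ u) • w := by
    intro u hu
    simp [hA, hu]
  have hAw : A w = a • w := by simp [hA, hlw]
  have hBW : ∀ u, l u = 0 → (φ - A) u = (1 - α) • T u := by
    intro u hu
    rw [LinearMap.sub_apply, hAW u hu, sub_smul, one_smul, hTu]
    abel
  have hlBw : l ((φ - A) w) = l (φ w) - a := by
    rw [LinearMap.sub_apply, hAw, map_sub, map_smul, hlw, smul_eq_mul, mul_one]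
  have hdec : ∀ (Y : Module.End K V), (∀ u, l u = 0 → Y u = 0) → Y w = 0 → Y = 0 := by
    intro Y h1 h2
    ext u
    have h3 := h1 (u - l u • w) (by simp [hlw])
    rw [map_sub, map_smul, h2, smul_zero, sub_zero] at h3
    simpa using h3
  refine ⟨A, φ - A, ?_, ?_, by abel⟩
  · apply good_of A g hgi (by omega) α⁻¹ a (inv_ne_zero hα0) ha0
    apply hdec
    · intro u hu
      have h1 := aeval_mod A (α • T) (Submodule.span K {w}) (LinearMap.ker l) ?_ ?_ ?_
        (g.comp (C α⁻¹ * X)) u hu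
      · rw [hsc α hα0, hgW u hu, sub_zero] at h1
        obtain ⟨c, hc⟩ := Submodule.mem_span_singleton.1 h1
        rw [map_mul, Module.End.mul_apply, ← hc]
        simp [hAw]
      · intro u hu
        rw [hAW u hu, LinearMap.smul_apply, add_sub_cancel_left]
        exact Submodule.smul_mem _ _ (Submodule.mem_span_singleton_self w)
      · intro u hu
        obtain ⟨c, rfl⟩ := Submodule.mem_span_singleton.1 hu
        rw [map_smul, hAw]
        exact Submodule.smul_mem _ _ (Submodule.smul_mem _ _ (Submodule.mem_span_singleton_self w))
      · intro u hu
        simp [hlT]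
    · rw [mul_comm, map_mul, Module.End.mul_apply]
      simp [hAw]
  · apply good_of (φ - A) g hgi (by omega) (1 - α)⁻¹ (l (φ w) - a) (inv_ne_zero hβ)
      (sub_ne_zero.2 (Ne.symm ha1))
    have hk : ∀ u, l u = 0 → aeval (φ - A) (g.comp (C (1 - α)⁻¹ * X)) u = 0 := by
      intro u hu
      have h1 := aeval_mod (φ - A) ((1 - α) • T) ⊥ (LinearMap.ker l) ?_ ?_ ?_
        (g.comp (C (1 - α)⁻¹ * X)) u hu
      · rw [hsc _ hβ, hgW u hu, sub_zero] at h1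
        simpa using h1
      · intro u hu
        rw [hBW u hu, LinearMap.smul_apply, sub_self]
        exact Submodule.zero_mem _
      · intro u hu
        rw [Submodule.mem_bot] at hu
        rw [hu, map_zero]
        exact Submodule.zero_mem _
      · intro u hu
        simp [hlT]
    apply hdec
    · intro u hu
      rw [map_mul, Module.End.mul_apply, hk u hu, map_zero]
    · rw [mul_comm, map_mul, Module.End.mul_apply]
      apply hk
      rw [map_sub, aeval_X, aeval_C, LinearMap.sub_apply, map_sub, hlBw,
        Module.algebraMap_end_apply, map_smul, hlw]
      simp

theorem split_cyclic {K V : Type*} [Field K] [Fintype K] (hF : 3 ≤ Fintype.card K)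
    [AddCommGroup V] [Module K V] (φ : Module.End K V) (n : ℕ)
    (b : Module.Basis (Fin n) K V) (v : V) (hb : ∀ i, b i = (φ ^ (i : ℕ)) v) : SplitEnd φ := by
  match n, b, hb with
  | 0, b, hb =>
    have : φ = algebraMap K (Module.End K V) 0 := b.ext (fun i => i.elim0)
    rw [this]; exact split_one hF 0
  | 1, b, hb =>
    have : φ = algebraMap K (Module.End K V) (b.repr (φ (b 0)) 0) := b.ext (fun i => by
      rw [Subsingleton.elim i 0, Module.algebraMap_end_apply]
      conv_lhs => rw [← b.sum_repr (φ (b 0))]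
      simp)
    rw [this]; exact split_one hF _
  | 2, b, hb =>
    obtain ⟨M, N, h, h1, h2, h3, h4⟩ := num_two K hF (b.repr (φ (b 1)) 0) (b.repr (φ (b 1)) 1)
    refine ⟨Matrix.toLin b b M, Matrix.toLin b b N, good_quad b M h1 h3, good_quad b N h2 h4, ?_⟩
    rw [← map_add, h]
    apply b.ext
    intro i
    rw [Matrix.toLin_self]
    fin_cases i
    · simp [hb]
    · simp only [Fin.mk_one, Fin.isValue]
      conv_lhs => rw [← b.sum_repr (φ (b 1))]
      rw [Fin.sum_univ_two, Fin.sum_univ_two]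
      rfl
  | m + 3, b, hb => exact split_cyc hF φ (m+2) (by omega) b v hb

theorem aeval_intertwine {K V W : Type*} [Field K] [AddCommGroup V] [Module K V] [AddCommGroup W]
    [Module K W] (A : Module.End K V) (B : Module.End K W) (h : V →ₗ[K] W)
    (hh : ∀ u, h (A u) = B (h u)) (p : K[X]) (u : V) : h (aeval A p u) = aeval B p (h u) := by
  have hk : ∀ k : ℕ, h ((A ^ k) u) = (B ^ k) (h u) := by
    intro k
    induction k with
    | zero => simp
    | succ k ih => rw [pow_succ', Module.End.mul_apply, pow_succ', Module.End.mul_apply, hh, ih]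
  induction p using Polynomial.induction_on' with
  | add p q hp hq => simp only [map_add, LinearMap.add_apply, hp, hq]
  | monomial k c =>
    rw [aeval_monomial, aeval_monomial, Module.End.mul_apply, Module.End.mul_apply,
      Module.algebraMap_end_apply, Module.algebraMap_end_apply, map_smul, hk]

theorem good_family {K V ι : Type*} [Field K] [AddCommGroup V] [Module K V] [Fintype ι]
    {W : ι → Type*} [∀ i, AddCommGroup (W i)] [∀ i, Module K (W i)]
    (A : Module.End K V) (B : ∀ i, Module.End K (W i)) (π : ∀ i, V →ₗ[K] W i)
    (hπ : ∀ u, (∀ i, π i u = 0) → u = 0) (h : ∀ i u, π i (A u) = B i (π i u))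
    (hB : ∀ i, GoodEnd (B i)) : GoodEnd A := by
  classical
  choose p hp h0 hz using hB
  have hne : ∏ i, p i ≠ 0 := Finset.prod_ne_zero_iff.2 fun i _ => (hp i).ne_zero
  refine ⟨UniqueFactorizationMonoid.radical (∏ i, p i), UniqueFactorizationMonoid.squarefree_radical, ?_, ?_⟩
  · intro hc
    obtain ⟨q, hq⟩ := UniqueFactorizationMonoid.radical_dvd_self (a := ∏ i, p i)
    have := congrArg (eval 0) hq
    rw [eval_mul, hc, zero_mul, eval_prod, Finset.prod_eq_zero_iff] at this
    obtain ⟨i, _, hi⟩ := this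
    exact h0 i hi
  · ext u
    apply hπ
    intro i
    rw [aeval_intertwine A (B i) (π i) (h i)]
    obtain ⟨q, hq⟩ := (UniqueFactorizationMonoid.dvd_radical_iff (hp i).isRadical hne).2
      (Finset.dvd_prod_of_mem p (Finset.mem_univ i))
    rw [hq, map_mul, hz i, zero_mul, LinearMap.zero_apply]

theorem split_quot {K : Type*} [Field K] [Fintype K] (hF : 3 ≤ Fintype.card K)
    (g : K[X]) (hg : g ≠ 0) :
    ∃ A B : Module.End K (K[X] ⧸ Submodule.span K[X] {g}), GoodEnd A ∧ GoodEnd B ∧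
      ∀ u, (X : K[X]) • u = A u + B u := by
  obtain ⟨A, B, hA, hB, h⟩ := split_cyclic hF (LinearMap.mulLeft K (AdjoinRoot.root g)) _
    (AdjoinRoot.powerBasis hg).basis 1 (by
      intro i
      rw [LinearMap.pow_mulLeft, PowerBasis.basis_eq_pow]
      simp)
  refine ⟨A, B, hA, hB, fun u => ?_⟩
  have := LinearMap.congr_fun h u
  refine Eq.trans ?_ this
  obtain ⟨r, rfl⟩ := Submodule.Quotient.mk_surjective _ u
  rfl

theorem split_all {K V : Type*} [Field K] [Fintype K] (hF : 3 ≤ Fintype.card K)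
    [AddCommGroup V] [Module K V] [Module.Finite K V] (φ : Module.End K V) : SplitEnd φ := by
  classical
  obtain ⟨ι, hι, p, hp, e, ⟨E⟩⟩ := Module.equiv_directSum_of_isTorsion
    (R := K[X]) (M := Module.AEval' φ) (Module.AEval.isTorsion_of_finiteDimensional K V φ)
  choose A B hA hB hAB using fun i => split_quot hF (p i ^ e i) (pow_ne_zero _ (hp i).ne_zero)
  let E' : V ≃ₗ[K] DirectSum ι fun i => K[X] ⧸ Submodule.span K[X] {p i ^ e i} :=
    (Module.AEval'.of φ).trans (E.restrictScalars K)
  have hE : ∀ u, E' (φ u) = (X : K[X]) • E' u := by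
    intro u
    show E (Module.AEval'.of φ (φ u)) = (X : K[X]) • E (Module.AEval'.of φ u)
    rw [← map_smul, Module.AEval'.X_smul_of]
  let π : ∀ i, V →ₗ[K] (K[X] ⧸ Submodule.span K[X] {p i ^ e i}) := fun i =>
    (DirectSum.component K ι _ i) ∘ₗ E'.toLinearMap
  have hπ : ∀ u, (∀ i, π i u = 0) → u = 0 := by
    intro u hu
    apply E'.injective
    rw [map_zero]
    exact DFinsupp.ext hu
  refine ⟨E'.symm.toLinearMap ∘ₗ DirectSum.lmap A ∘ₗ E'.toLinearMap,
    E'.symm.toLinearMap ∘ₗ DirectSum.lmap B ∘ₗ E'.toLinearMap,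
    good_family _ A π hπ ?_ hA, good_family _ B π hπ ?_ hB, ?_⟩
  · intro i u
    simp [π, DirectSum.component]
    rfl
  · intro i u
    simp [π, DirectSum.component]
    rfl
  · ext u
    apply E'.injective
    rw [hE]
    simp only [LinearMap.add_apply, map_add, LinearMap.comp_apply, LinearEquiv.coe_coe,
      LinearEquiv.apply_symm_apply]
    refine DFinsupp.ext fun i => ?_
    exact hAB i _

theorem good_matrix {K : Type*} [Field K] {n : ℕ} (A : Module.End K (Fin n → K)) (hA : GoodEnd A) :
    IsUnit (LinearMap.toMatrixAlgEquiv' A) ∧ IsSemisimpleMatrix (LinearMap.toMatrixAlgEquiv' A) := by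
  obtain ⟨p, hp, h0, hz⟩ := hA
  set M := LinearMap.toMatrixAlgEquiv' A with hM
  have hz' : aeval M p = 0 := by
    have := aeval_algHom_apply (LinearMap.toMatrixAlgEquiv' (R := K) (n := Fin n)).toAlgHom A p
    rw [hz, map_zero] at this
    exact this
  refine ⟨?_, hp.squarefree_of_dvd (minpoly.dvd K M hz')⟩
  have h1 : p = C (p.eval 0) + X * p.divX := by
    conv_lhs => rw [← p.divX_mul_X_add]
    rw [coeff_zero_eq_eval_zero]; ring
  rw [h1, map_add, map_mul, aeval_X, aeval_C, Algebra.algebraMap_eq_smul_one] at hz'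
  apply IsUnit.of_mul_eq_one (-(p.eval 0)⁻¹ • aeval M p.divX)
  rw [mul_smul_comm, eq_neg_of_add_eq_zero_right hz', smul_neg, neg_smul, neg_neg, smul_smul,
    inv_mul_cancel₀ h0, one_smul]

theorem stmt7 (F : Type*) [Field F] [Fintype F] (hF : 3 ≤ Fintype.card F)
    (n : ℕ) (hn : 2 ≤ n) :
    ∀ M : Matrix (Fin n) (Fin n) F, ∃ A B : Matrix (Fin n) (Fin n) F,
      IsUnit A ∧ IsUnit B ∧ IsSemisimpleMatrix A ∧ IsSemisimpleMatrix B ∧ M = A + B := by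
  intro M
  obtain ⟨A, B, hA, hB, h⟩ := split_all hF (Matrix.toLinAlgEquiv' M)
  obtain ⟨h1, h2⟩ := good_matrix A hA
  obtain ⟨h3, h4⟩ := good_matrix B hB
  refine ⟨_, _, h1, h3, h2, h4, ?_⟩
  rw [← map_add, ← h]
  exact (LinearMap.toMatrixAlgEquiv'_toLinAlgEquiv' M).symm
end

section
/- Let K be a field, let n ≥ 2, and let A ∈ M_n(K). Then A is nonscalar (i.e., A is not of the form a·I_n for a ∈ K) if and only if A is quasi-cyclic. -/
/-- A matrix `A ∈ M_n(K)` is quasi-cyclic if for every vector `(a_1, …, a_n)` with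
`a_1 + ⋯ + a_n = Tr A`, the matrix `A` is similar over `K` to a matrix whose diagonal
entries are `a_1, …, a_n`. -/
def IsQuasiCyclic {n : ℕ} {K : Type*} [Field K]
    (A : Matrix (Fin n) (Fin n) K) : Prop :=
  ∀ a : Fin n → K, (∑ i, a i) = Matrix.trace A →
    ∃ (g : GL (Fin n) K) (B : Matrix (Fin n) (Fin n) K),
      (↑g : Matrix (Fin n) (Fin n) K) * A * (↑g⁻¹ : Matrix (Fin n) (Fin n) K) = B ∧
        ∀ i, B i i = a i

open Module in
/-- A functional vanishing on `p` and equal to `1` at `v`. -/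
lemma exists_functional {K V : Type*} [Field K] [AddCommGroup V] [Module K V]
    (p : Submodule K V) (v : V) (hv : v ∉ p) :
    ∃ g : V →ₗ[K] K, g v = 1 ∧ ∀ x ∈ p, g x = 0 := by
  obtain ⟨g, hg, hgv⟩ := LinearMap.exists_extend_of_notMem (0 : p →ₗ[K] K) hv 1
  exact ⟨g, hgv, fun x hx => by simpa using LinearMap.congr_fun hg ⟨x, hx⟩⟩

/-- Compression of `f` to `ker φ` along `v`. -/
def compress {K V : Type*} [Field K] [AddCommGroup V] [Module K V]
    (f : V →ₗ[K] V) (φ : V →ₗ[K] K) (v : V) (hv : φ v = 1) :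
    LinearMap.ker φ →ₗ[K] LinearMap.ker φ :=
  LinearMap.codRestrict (LinearMap.ker φ)
    ((f - (φ.comp f).smulRight v).comp (LinearMap.ker φ).subtype)
    (fun x => by simp [hv])

lemma compress_coe {K V : Type*} [Field K] [AddCommGroup V] [Module K V]
    (f : V →ₗ[K] V) (φ : V →ₗ[K] K) (v : V) (hv : φ v = 1) (x : LinearMap.ker φ) :
    (compress f φ v hv x : V) = f x - φ (f x) • v := rfl

open Module in
lemma extend_basis {K V : Type*} [Field K] [AddCommGroup V] [Module K V]
    (f : V →ₗ[K] V) (φ : V →ₗ[K] K) (v : V) (hv : φ v = 1) {n : ℕ}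
    (b : Basis (Fin n) K (LinearMap.ker φ)) :
    ∃ B : Basis (Fin (n + 1)) K V, LinearMap.toMatrix B B f 0 0 = φ (f v) ∧
      ∀ i : Fin n, LinearMap.toMatrix B B f i.succ i.succ =
        LinearMap.toMatrix b b (compress f φ v hv) i i := by
  let B : Basis (Fin (n + 1)) K V := Basis.mkFinCons v b
    (fun c x hx h => by
      have := congrArg φ h
      have hx' : φ x = 0 := hx
      simpa [hv, hx'] using this)
    (fun z => ⟨-φ z, by simp [hv]⟩)
  have hB0 : B 0 = v := by simp [B]
  have hBs : ∀ i : Fin n, B i.succ = b i := by intro i; simp [B]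
  have key : ∀ (x : V) (y : LinearMap.ker φ), (y : V) = x - φ x • v →
      B.repr x 0 = φ x ∧ ∀ i : Fin n, B.repr x i.succ = b.repr y i := by
    intro x y hy
    have e : x = ∑ i, (Fin.cons (φ x) (b.repr y) : Fin (n + 1) → K) i • B i := by
      rw [Fin.sum_univ_succ]
      simp only [Fin.cons_zero, Fin.cons_succ, hB0, hBs]
      have h1 : (y : V) = ∑ i, b.repr y i • (b i : V) := by
        have h3 := congrArg Subtype.val (b.sum_repr y)
        rw [Submodule.coe_sum] at h3
        exact h3.symm
      rw [← h1, hy]; abel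
    have h2 : ∀ j, B.repr x j = (Fin.cons (φ x) (b.repr y) : Fin (n + 1) → K) j := by
      intro j
      conv_lhs => rw [e]
      rw [B.repr_sum_self]
    exact ⟨by simpa using h2 0, fun i => by simpa using h2 i.succ⟩
  refine ⟨B, ?_, fun i => ?_⟩
  · rw [LinearMap.toMatrix_apply, hB0]
    exact (key (f v) ⟨f v - φ (f v) • v, by simp [hv]⟩ rfl).1
  · rw [LinearMap.toMatrix_apply, LinearMap.toMatrix_apply, hBs]
    exact (key (f (b i)) (compress f φ v hv (b i)) rfl).2 i

open Module in
lemma exists_good {K V : Type*} [Field K] [AddCommGroup V] [Module K V] [FiniteDimensional K V]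
    (n : ℕ) (hV : finrank K V = n + 2) (f : V →ₗ[K] V)
    (hf : ¬ ∃ c : K, ∀ x, f x = c • x) (a : K) :
    ∃ (φ : V →ₗ[K] K) (v : V) (hv : φ v = 1), φ (f v) = a ∧
      (n = 0 ∨ ¬ ∃ c : K, ∀ x, compress f φ v hv x = c • x) := by
  have h1 : ∃ v, LinearIndependent K ![v, f v] := by
    by_contra! h
    obtain ⟨c, hc⟩ := LinearMap.exists_eq_smul_id_of_forall_notLinearIndependent h
    exact hf ⟨c, fun x => by rw [hc]; simp⟩
  obtain ⟨v, hli⟩ := h1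
  rw [LinearIndependent.pair_iff] at hli
  have hv0 : v ∉ (⊥ : Submodule K V) := by
    intro h
    have := hli 1 0 (by simpa using h)
    simp at this
  have hfv : f v ∉ Submodule.span K {v} := by
    intro h
    obtain ⟨c, hc⟩ := Submodule.mem_span_singleton.1 h
    have := hli c (-1) (by rw [hc]; simp)
    simp at this
  obtain ⟨θ, hθ, -⟩ := exists_functional _ v hv0
  obtain ⟨ψ, hψ, hψ'⟩ := exists_functional _ (f v) hfv
  have hψv : ψ v = 0 := hψ' v (Submodule.mem_span_singleton_self v)
  obtain ⟨φ, hφ, hφf⟩ : ∃ φ : V →ₗ[K] K, φ v = 1 ∧ φ (f v) = a :=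
    ⟨θ + (a - θ (f v)) • ψ, by simp [hθ, hψv], by simp [hψ]⟩
  by_cases hn : n = 0
  · exact ⟨φ, v, hφ, hφf, Or.inl hn⟩
  by_cases hs : ∃ c : K, ∀ x, compress f φ v hφ x = c • x
  swap
  · exact ⟨φ, v, hφ, hφf, Or.inr hs⟩
  obtain ⟨c, hc⟩ := hs
  have hlt : ∃ u, u ∉ Submodule.span K (Set.range ![v, f v]) := by
    by_contra! h
    have h2 := finrank_range_le_card (R := K) ![v, f v]
    rw [Set.finrank, (Submodule.eq_top_iff').2 h, finrank_top, hV] at h2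
    simp at h2
    omega
  obtain ⟨u₀, hu₀⟩ := hlt
  obtain ⟨χ, hχ, hχ'⟩ := exists_functional _ u₀ hu₀
  have hχv : χ v = 0 := hχ' v (Submodule.subset_span ⟨0, rfl⟩)
  have hχf : χ (f v) = 0 := hχ' (f v) (Submodule.subset_span ⟨1, rfl⟩)
  have hφ2 : (φ + χ) v = 1 := by simp [hφ, hχv]
  refine ⟨φ + χ, v, hφ2, by simp [hφf, hχf], Or.inr ?_⟩
  rintro ⟨c', hc'⟩
  obtain ⟨u, hu, hχu⟩ : ∃ u, φ u = 0 ∧ χ u = 1 :=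
    ⟨u₀ - φ u₀ • v, by simp [hφ], by simp [hχ, hχv]⟩
  have e1 := congrArg Subtype.val (hc ⟨u, hu⟩)
  have e2 := congrArg Subtype.val (hc' ⟨u - v, by simp [hφ, hu, hχu, hχv]⟩)
  rw [compress_coe] at e1 e2
  simp only [Submodule.coe_smul] at e1 e2
  rw [sub_eq_iff_eq_add] at e1
  generalize (φ + χ) (f (u - v)) = r at e2
  rw [map_sub, e1] at e2
  generalize φ (f u) = s at e2
  have e3 := congrArg χ e2
  simp [hχu, hχv, hχf] at e3
  have e4 := congrArg ψ e2
  subst e3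
  simp [hψv, hψ] at e4

open Module in
theorem main_aux {K : Type*} [Field K] (n : ℕ) : ∀ (V : Type _) [AddCommGroup V] [Module K V]
    [FiniteDimensional K V] (_ : finrank K V = n + 1) (f : V →ₗ[K] V)
    (_ : n = 0 ∨ ¬ ∃ c : K, ∀ x, f x = c • x) (a : Fin (n + 1) → K)
    (_ : ∑ i, a i = LinearMap.trace K V f),
    ∃ B : Basis (Fin (n + 1)) K V, ∀ i, LinearMap.toMatrix B B f i i = a i := by
  induction n with
  | zero =>
    intro V _ _ _ hV f _ a ha
    let B := finBasisOfFinrankEq K V hV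
    refine ⟨B, fun i => ?_⟩
    rw [LinearMap.trace_eq_matrix_trace K B] at ha
    simp [Matrix.trace] at ha
    have hi : i = 0 := by omega
    rw [hi]
    exact ha.symm
  | succ n ih =>
    intro V _ _ _ hV f hf a ha
    obtain ⟨φ, v, hv, hφ, hs⟩ := exists_good n hV f (hf.resolve_left (by omega)) (a 0)
    have hW : finrank K (LinearMap.ker φ) = n + 1 := by
      have h := LinearMap.finrank_range_add_finrank_ker φ
      have h2 : LinearMap.range φ = ⊤ := LinearMap.range_eq_top.2 (fun c => ⟨c • v, by simp [hv]⟩)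
      rw [h2, finrank_top, finrank_self, hV] at h
      omega
    obtain ⟨b, hb⟩ := ih (LinearMap.ker φ) hW (compress f φ v hv) hs (fun i => a i.succ) (by
      obtain ⟨B, hB0, hB⟩ := extend_basis f φ v hv (finBasisOfFinrankEq K _ hW)
      rw [LinearMap.trace_eq_matrix_trace K B, Matrix.trace, Fin.sum_univ_succ,
        Fin.sum_univ_succ (n := n + 1) (f := fun i => Matrix.diag _ i)] at ha
      simp only [Matrix.diag_apply, hB0, hφ, hB] at ha
      rw [LinearMap.trace_eq_matrix_trace K (finBasisOfFinrankEq K _ hW), Matrix.trace]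
      exact add_left_cancel ha)
    obtain ⟨B, hB0, hB⟩ := extend_basis f φ v hv b
    refine ⟨B, fun i => ?_⟩
    refine Fin.cases ?_ (fun j => ?_) i
    · rw [hB0, hφ]
    · rw [hB, hb]

theorem stmt9 (K : Type*) [Field K] (n : ℕ) (hn : 2 ≤ n)
    (A : Matrix (Fin n) (Fin n) K) :
    (∀ a : K, A ≠ a • (1 : Matrix (Fin n) (Fin n) K)) ↔ IsQuasiCyclic A := by
  constructor
  · intro h a ha
    obtain ⟨m, rfl⟩ : ∃ m, n = m + 1 := ⟨n - 1, by omega⟩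
    have hns : ¬ ∃ c : K, ∀ x, Matrix.toLin' A x = c • x := by
      rintro ⟨c, hc⟩
      apply h c
      apply Matrix.toLin'.injective
      ext1 x
      ext i
      simp [hc]
    obtain ⟨B, hB⟩ := main_aux m (Fin (m + 1) → K) (by simp) (Matrix.toLin' A) (Or.inr hns) a
      (by rw [ha, Matrix.trace_toLin'_eq])
    let E := Pi.basisFun K (Fin (m + 1))
    have e : B.toMatrix E * A * E.toMatrix B = LinearMap.toMatrix B B (Matrix.toLin' A) := by
      rw [← basis_toMatrix_mul_linearMap_toMatrix_mul_basis_toMatrix B E B E,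
        show LinearMap.toMatrix E E (Matrix.toLin' A) = A from LinearMap.toMatrix'_toLin' A]
    refine ⟨⟨B.toMatrix E, E.toMatrix B, B.toMatrix_mul_toMatrix_flip E,
      E.toMatrix_mul_toMatrix_flip B⟩, _, rfl, fun i => ?_⟩
    rw [← hB i, ← e]
    rfl
  · rintro h c rfl
    let i0 : Fin n := ⟨0, by omega⟩
    let i1 : Fin n := ⟨1, by omega⟩
    obtain ⟨g, B, hgB, hB⟩ := h (fun i => c + (Pi.single i0 1 : Fin n → K) i - (Pi.single i1 1 : Fin n → K) i) (by
      rw [Finset.sum_sub_distrib, Finset.sum_add_distrib]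
      simp [Matrix.trace_smul, Matrix.trace_one, mul_comm])
    have h0 := hB i0
    have h2 : B = c • 1 := by
      rw [← hgB]; simp
    have h3 : i0 ≠ i1 := by simp [i0, i1]
    rw [h2] at h0
    simp [h3] at h0
end

section
/- Suppose p does not divide k, and set d := gcd(k, q−1), d_2 := gcd(k, q^2−1), d_3 := gcd(k, q^3−1). If q^2 ≥ (d−1)^6 + 6d, q > (d_2−1)^2, and q^3 > (d_3−1)^4, then every matrix in M_n(𝔽_q) can be written as A^k + B^k with A, B ∈ M_n(𝔽_q). -/
open Finset in
lemma wr_rootcount {K : Type*} [Field K] [Fintype K] [DecidableEq K] (k : ℕ) (hk : 1 ≤ k) (x : K)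
    (hx : x ≠ 0) :
    #{y : K | x ^ k = y ^ k} ≤ Nat.gcd k (Fintype.card K - 1) := by
  set d := Nat.gcd k (Fintype.card K - 1) with hd
  have hd0 : 0 < d := Nat.gcd_pos_of_pos_left _ hk
  have hinj : #{y : K | x ^ k = y ^ k} ≤ #(Polynomial.nthRoots d (1 : K)).toFinset := by
    apply Finset.card_le_card_of_injOn (fun y => y / x)
    · intro y hy
      simp only [coe_filter, mem_univ, true_and, Set.mem_ofPred_eq] at hy
      have hy0 : y ≠ 0 := by
        rintro rfl
        rw [zero_pow (by omega)] at hy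
        exact hx (pow_eq_zero_iff (by omega) |>.1 hy)
      have h1 : (y / x) ^ k = 1 := by
        rw [div_pow, ← hy, div_self (pow_ne_zero _ hx)]
      have h2 : (y / x) ^ (Fintype.card K - 1) = 1 :=
        FiniteField.pow_card_sub_one_eq_one _ (div_ne_zero hy0 hx)
      simp only [Multiset.mem_toFinset, SetLike.mem_coe]
      rw [Polynomial.mem_nthRoots hd0, hd]
      exact pow_gcd_eq_one.2 ⟨h1, h2⟩
    · intro y _ z _ h
      simpa [div_left_inj' hx] using h
  refine hinj.trans ((Multiset.toFinset_card_le _).trans (Polynomial.card_nthRoots _ _))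

noncomputable def wrS {K : Type*} [Field K] [Fintype K] (ψ : AddChar K ℂ) (k : ℕ) (a : K) : ℂ :=
  ∑ x : K, ψ (a * x ^ k)

lemma wr_S_zero {K : Type*} [Field K] [Fintype K] (ψ : AddChar K ℂ) (k : ℕ) : wrS ψ k 0 = Fintype.card K := by
  simp [wrS]

lemma wr_S_mul {K : Type*} [Field K] [Fintype K] (ψ : AddChar K ℂ) (k : ℕ) (a c : K) (hc : c ≠ 0) : wrS ψ k (a * c ^ k) = wrS ψ k a := by
  unfold wrS
  rw [← Equiv.sum_comp (Equiv.mulLeft₀ c hc) (fun x => ψ (a * x ^ k))]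
  apply Finset.sum_congr rfl
  intro x _
  simp only [Equiv.mulLeft₀, Units.mulLeft_apply, Units.val_mk0, mul_pow]
  congr 1
  ring

lemma wr_sumS {K : Type*} [Field K] [Fintype K] [DecidableEq K] (ψ : AddChar K ℂ)
    (hψ : ψ.IsPrimitive) (k : ℕ) (hk : 1 ≤ k) : ∑ a : K, wrS ψ k a = Fintype.card K := by
  unfold wrS
  rw [Finset.sum_comm]
  simp_rw [AddChar.sum_mulShift _ hψ]
  have : ∀ x : K, (x ^ k = 0) = (x = 0) := fun x => by
    rw [pow_eq_zero_iff (by omega)]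
  simp [this]

lemma wr_E_card {K : Type*} [Field K] [Fintype K] [DecidableEq K] : ((Finset.univ.erase (0:K)).card : ℝ) = Fintype.card K - 1 := by
  rw [Finset.card_erase_of_mem (Finset.mem_univ _), Nat.cast_sub]
  · simp [Finset.card_univ]
  · exact Fintype.card_pos

lemma wr_sumS' {K : Type*} [Field K] [Fintype K] [DecidableEq K] (ψ : AddChar K ℂ)
    (hψ : ψ.IsPrimitive) (k : ℕ) (hk : 1 ≤ k) : ∑ a ∈ Finset.univ.erase (0:K), wrS ψ k a = 0 := by
  have := wr_sumS ψ hψ k hk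
  rw [← Finset.add_sum_erase _ _ (Finset.mem_univ (0:K)), wr_S_zero] at this
  simpa using this

lemma wr_sumS2_eq {K : Type*} [Field K] [Fintype K] [DecidableEq K] (ψ : AddChar K ℂ)
    (hψ : ψ.IsPrimitive) (k : ℕ) : ∑ a : K, ‖wrS ψ k a‖ ^ 2 =
    ∑ x : K, (Fintype.card K : ℝ) * (Finset.univ.filter (fun y : K => x ^ k = y ^ k)).card := by
  have : ((∑ a : K, ‖wrS ψ k a‖ ^ 2 : ℝ) : ℂ) = ((∑ x : K, (Fintype.card K : ℝ) *
      (Finset.univ.filter (fun y : K => x ^ k = y ^ k)).card : ℝ) : ℂ) := by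
    push_cast
    simp_rw [← Complex.mul_conj', wrS, map_sum, Finset.sum_mul_sum, ← AddChar.map_neg_eq_conj,
      ← AddChar.map_add_eq_mul]
    rw [Finset.sum_comm]
    apply Finset.sum_congr rfl
    intro x _
    rw [Finset.sum_comm]
    have : ∀ y a : K, a * x ^ k + -(a * y ^ k) = a * (x ^ k - y ^ k) := fun y a => by ring
    simp_rw [this, AddChar.sum_mulShift _ hψ, sub_eq_zero]
    push_cast
    rw [← Finset.sum_filter, Finset.sum_const, nsmul_eq_mul, mul_comm]
  exact_mod_cast this

lemma wr_sumS2 {K : Type*} [Field K] [Fintype K] [DecidableEq K] (ψ : AddChar K ℂ)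
    (hψ : ψ.IsPrimitive) (k : ℕ) (hk : 1 ≤ k) (d : ℕ)
    (hd : d = Nat.gcd k (Fintype.card K - 1)) : ∑ a ∈ Finset.univ.erase (0:K), ‖wrS ψ k a‖ ^ 2 ≤
    Fintype.card K * (Fintype.card K - 1) * (d - 1) := by
  have h := wr_sumS2_eq ψ hψ k
  rw [← Finset.add_sum_erase _ _ (Finset.mem_univ (0:K)), wr_S_zero,
    ← Finset.add_sum_erase Finset.univ _ (Finset.mem_univ (0:K))] at h
  have h0 : (Finset.univ.filter (fun y : K => 0 ^ k = y ^ k)).card = 1 := by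
    rw [Finset.card_eq_one]
    refine ⟨(0:K), ?_⟩
    ext y
    simp [zero_pow (show k ≠ 0 by omega), eq_comm, show k ≠ 0 by omega]
  rw [h0] at h
  have h1 : ∑ x ∈ Finset.univ.erase (0:K), (Fintype.card K : ℝ) *
      (Finset.univ.filter (fun y : K => x ^ k = y ^ k)).card ≤
      ∑ x ∈ Finset.univ.erase (0:K), (Fintype.card K : ℝ) * d := by
    apply Finset.sum_le_sum
    intro x hx
    gcongr
    rw [hd]
    exact wr_rootcount k hk x (Finset.ne_of_mem_erase hx)
  rw [Finset.sum_const, nsmul_eq_mul, wr_E_card] at h1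
  simp only [Complex.norm_natCast, Nat.cast_one, mul_one] at h
  nlinarith

lemma wr_sumS3 {K : Type*} [Field K] [Fintype K] [DecidableEq K] (ψ : AddChar K ℂ)
    (hψ : ψ.IsPrimitive) (k : ℕ) (hk : 1 ≤ k) (d : ℕ)
    (hd : d = Nat.gcd k (Fintype.card K - 1)) : ∑ a ∈ Finset.univ.erase (0:K), ‖wrS ψ k a - 1‖ ^ 2 ≤
    (Fintype.card K - 1) * (Fintype.card K * (d - 1) + 1) := by
  have h := wr_sumS2 ψ hψ k hk d hd
  have h0 := congrArg Complex.re (wr_sumS' ψ hψ k hk)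
  rw [Complex.re_sum] at h0
  have h1 : ∀ a : K, ‖wrS ψ k a - 1‖ ^ 2 = ‖wrS ψ k a‖ ^ 2 - 2 * (wrS ψ k a).re + 1 := by
    intro a
    rw [← Complex.normSq_eq_norm_sq, ← Complex.normSq_eq_norm_sq, Complex.normSq_apply,
      Complex.normSq_apply]
    simp
    ring
  simp_rw [h1, Finset.sum_add_distrib, Finset.sum_sub_distrib, ← Finset.mul_sum]
  rw [h0, Finset.sum_const, nsmul_eq_mul, wr_E_card]
  simp only [Complex.zero_re]
  nlinarith

lemma wr_sup {K : Type*} [Field K] [Fintype K] [DecidableEq K] (ψ : AddChar K ℂ)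
    (hψ : ψ.IsPrimitive) (k : ℕ) (hk : 1 ≤ k) (d : ℕ)
    (hd : d = Nat.gcd k (Fintype.card K - 1)) (a₀ : K) (ha : a₀ ≠ 0) : ‖wrS ψ k a₀‖ ^ 2 ≤ ((d:ℝ) - 1) ^ 2 * (Fintype.card K : ℝ) := by
  classical
  set E := Finset.univ.erase (0:K) with hE
  set r : K → ℕ := fun a => (E.filter (fun c => a₀ * c ^ k = a)).card with hr
  have hmaps : ∀ c ∈ E, a₀ * c ^ k ∈ E := by
    intro c hc
    simp [hE] at hc ⊢
    exact ⟨ha, fun h => absurd h hc⟩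
  have fibC : ∀ g : K → ℂ, ∑ c ∈ E, g (a₀ * c ^ k) = ∑ a ∈ E, (r a : ℂ) * g a := by
    intro g
    rw [← Finset.sum_fiberwise_of_maps_to hmaps]
    apply Finset.sum_congr rfl
    intro a _
    rw [Finset.sum_congr rfl (g := fun _ => g a), Finset.sum_const, nsmul_eq_mul]
    intro c hc
    rw [(Finset.mem_filter.1 hc).2]
  have fibR : ∀ g : K → ℝ, ∑ c ∈ E, g (a₀ * c ^ k) = ∑ a ∈ E, (r a : ℝ) * g a := by
    intro g
    rw [← Finset.sum_fiberwise_of_maps_to hmaps]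
    apply Finset.sum_congr rfl
    intro a _
    rw [Finset.sum_congr rfl (g := fun _ => g a), Finset.sum_const, nsmul_eq_mul]
    intro c hc
    rw [(Finset.mem_filter.1 hc).2]
  have hQ : (1:ℝ) < Fintype.card K := by exact_mod_cast Fintype.one_lt_card
  have hEc : (E.card : ℝ) = Fintype.card K - 1 := wr_E_card
  have hr1 : ∑ a ∈ E, (r a : ℝ) = Fintype.card K - 1 := by
    have := fibR (fun _ => 1)
    simp at this
    rw [← this, hEc]
  have hr2 : ∑ a ∈ E, (r a : ℝ) * r a ≤ (Fintype.card K - 1) * d := by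
    rw [← fibR (fun a => (r a : ℝ)), ← hEc, ← nsmul_eq_mul, ← Finset.sum_const]
    apply Finset.sum_le_sum
    intro c hc
    norm_cast
    refine le_trans (Finset.card_le_card ?_)
      ((wr_rootcount k hk c (Finset.ne_of_mem_erase hc)).trans hd.ge)
    intro y hy
    simp only [Finset.mem_filter] at hy
    simp only [Finset.mem_filter, Finset.mem_univ, true_and]
    exact (mul_left_cancel₀ ha hy.2).symm
  have hr3 : ∑ a ∈ E, ((r a : ℝ) - 1) ^ 2 ≤ ((Fintype.card K : ℝ) - 1) * ((d:ℝ) - 1) := by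
    have : ∀ a, ((r a : ℝ) - 1) ^ 2 = r a * r a - 2 * r a + 1 := fun a => by ring
    simp_rw [this, Finset.sum_add_distrib, Finset.sum_sub_distrib, ← Finset.mul_sum]
    rw [hr1, Finset.sum_const, nsmul_eq_mul, hEc]
    nlinarith
  have key : ((Fintype.card K : ℂ) - 1) * wrS ψ k a₀ = ∑ a ∈ E, ((r a : ℂ) - 1) * wrS ψ k a := by
    simp_rw [sub_mul, Finset.sum_sub_distrib, one_mul]
    rw [hE, wr_sumS' ψ hψ k hk, ← hE, ← fibC, Finset.sum_congr rfl (g := fun _ => wrS ψ k a₀)]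
    · rw [Finset.sum_const, nsmul_eq_mul]
      have : (E.card : ℂ) = Fintype.card K - 1 := by exact_mod_cast congrArg (Complex.ofReal) hEc
      rw [this]
      ring
    · intro c hc
      exact wr_S_mul ψ k a₀ c (Finset.ne_of_mem_erase hc)
  have hn : ((Fintype.card K : ℝ) - 1) * ‖wrS ψ k a₀‖ ≤ ∑ a ∈ E, |(r a : ℝ) - 1| * ‖wrS ψ k a‖ := by
    have := congrArg norm key
    rw [norm_mul] at this
    have h1 : ‖(Fintype.card K : ℂ) - 1‖ = (Fintype.card K : ℝ) - 1 := by
      have : (Fintype.card K : ℂ) - 1 = (((Fintype.card K : ℝ) - 1 : ℝ) : ℂ) := by push_cast; ring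
      rw [this, Complex.norm_real, Real.norm_of_nonneg (by linarith)]
    rw [h1] at this
    rw [this]
    refine (norm_sum_le _ _).trans (le_of_eq ?_)
    apply Finset.sum_congr rfl
    intro a _
    rw [norm_mul]
    congr 1
    have : (r a : ℂ) - 1 = (((r a : ℝ) - 1 : ℝ) : ℂ) := by push_cast; ring
    rw [this, Complex.norm_real, Real.norm_eq_abs]
  have hcs := Finset.sum_mul_sq_le_sq_mul_sq E (fun a => |(r a : ℝ) - 1|) (fun a => ‖wrS ψ k a‖)
  simp only [sq_abs] at hcs
  have hs2 := wr_sumS2 ψ hψ k hk d hd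
  rw [← hE] at hs2
  have hA : (((Fintype.card K : ℝ) - 1) * ‖wrS ψ k a₀‖) ^ 2 ≤
      (((Fintype.card K : ℝ) - 1) * ((d:ℝ) - 1)) *
        ((Fintype.card K : ℝ) * ((Fintype.card K : ℝ) - 1) * ((d:ℝ) - 1)) := by
    refine (pow_le_pow_left₀ (by have := norm_nonneg (wrS ψ k a₀); nlinarith) hn 2).trans
      (hcs.trans ?_)
    apply mul_le_mul hr3 hs2
    · positivity
    · exact le_trans (by positivity) hr3
  have hB : ((Fintype.card K : ℝ) - 1) ^ 2 * ‖wrS ψ k a₀‖ ^ 2 ≤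
      ((Fintype.card K : ℝ) - 1) ^ 2 * (((d:ℝ) - 1) ^ 2 * (Fintype.card K : ℝ)) := by
    calc _ = (((Fintype.card K : ℝ) - 1) * ‖wrS ψ k a₀‖) ^ 2 := by ring
      _ ≤ _ := hA
      _ = _ := by ring
  exact le_of_mul_le_mul_left hB (by nlinarith)

/-- Main solvability criterion. -/
lemma wr_main {K : Type*} [Field K] [Fintype K] [DecidableEq K] (ψ : AddChar K ℂ)
    (hψ : ψ.IsPrimitive) (k : ℕ) (hk : 1 ≤ k) (d : ℕ)
    (hd : d = Nat.gcd k (Fintype.card K - 1)) (s : ℕ) (t : K) (ht : t ≠ 0)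
    (hbig : (((d:ℝ) - 1) ^ 2 * (Fintype.card K : ℝ)) ^ s *
      ((Fintype.card K : ℝ) * ((d:ℝ) - 1) * ((Fintype.card K : ℝ) * ((d:ℝ) - 1) + 1)) <
        (Fintype.card K : ℝ) ^ (2 * (s + 1))) :
    ∃ x : Fin (s + 1) → K, ∑ i, x i ^ k = t := by
  by_contra hcon
  push Not at hcon
  set E := Finset.univ.erase (0:K) with hE
  set Q : ℝ := (Fintype.card K : ℝ) with hQdef
  have hQ : (1:ℝ) < Q := by rw [hQdef]; exact_mod_cast Fintype.one_lt_card
  have hEc : (E.card : ℝ) = Q - 1 := wr_E_card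
  have h0 : ∑ a : K, wrS ψ k a ^ (s + 1) * ψ (-(a * t)) = 0 := by
    unfold wrS
    simp_rw [Fintype.sum_pow, Finset.sum_mul]
    rw [Finset.sum_comm]
    apply Finset.sum_eq_zero
    intro x _
    have : ∀ a : K, (∏ i, ψ (a * x i ^ k)) * ψ (-(a * t)) = ψ (a * (∑ i, x i ^ k - t)) := by
      intro a
      have hp : ∀ f : Fin (s + 1) → K, ψ (∑ i, f i) = ∏ i, ψ (f i) := fun f =>
        map_prod ψ.toMonoidHom (fun i => Multiplicative.ofAdd (f i)) Finset.univ
      rw [mul_sub, Finset.mul_sum, sub_eq_add_neg, AddChar.map_add_eq_mul, hp]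
    simp_rw [this, AddChar.sum_mulShift _ hψ]
    simp [sub_eq_zero, hcon x]
  rw [← Finset.add_sum_erase _ _ (Finset.mem_univ (0:K)), wr_S_zero, ← hE] at h0
  simp only [zero_mul, neg_zero, AddChar.map_zero_eq_one, mul_one] at h0
  have havg : ∀ c ∈ E, ∑ a ∈ E, wrS ψ k a ^ (s + 1) * ψ (-(a * t)) =
      ∑ a ∈ E, wrS ψ k a ^ (s + 1) * ψ (-a * t * c ^ k) := by
    intro c hc
    have hc0 : c ≠ 0 := Finset.ne_of_mem_erase hc
    symm
    apply Finset.sum_bij (fun a _ => a * c ^ k)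
    · intro a ha
      simp [hE] at ha ⊢
      exact ⟨ha, fun h => absurd h hc0⟩
    · intro a _ b _ h
      exact mul_right_cancel₀ (pow_ne_zero _ hc0) h
    · intro b hb
      refine ⟨b / c ^ k, ?_, ?_⟩
      · simp [hE] at hb ⊢
        exact ⟨hb, fun h => absurd h hc0⟩
      · field_simp
    · intro a _
      rw [wr_S_mul ψ k a c hc0]
      congr 2
      ring
  have hsum : ((Q - 1 : ℝ) : ℂ) * ∑ a ∈ E, wrS ψ k a ^ (s + 1) * ψ (-(a * t)) =
      ∑ a ∈ E, wrS ψ k a ^ (s + 1) * (wrS ψ k (-a * t) - 1) := by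
    have h1 := Finset.sum_congr (rfl : E = E) havg
    rw [Finset.sum_const, nsmul_eq_mul, Finset.sum_comm] at h1
    rw [← hEc]
    push_cast
    rw [h1]
    apply Finset.sum_congr rfl
    intro a _
    rw [← Finset.mul_sum]
    congr 1
    unfold wrS
    rw [← Finset.add_sum_erase _ _ (Finset.mem_univ (0:K)), zero_pow (by omega)]
    simp [hE]
  have hT : ∑ a ∈ E, wrS ψ k a ^ (s + 1) * ψ (-(a * t)) = -((Q : ℂ)) ^ (s + 1) := by
    rw [hQdef]
    push_cast
    linear_combination h0
  rw [hT] at hsum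
  have hn := congrArg norm hsum
  rw [norm_mul, norm_neg, norm_pow, Complex.norm_real, Complex.norm_real,
    Real.norm_of_nonneg (by linarith), Real.norm_of_nonneg (by linarith)] at hn
  set M : ℝ := ((d:ℝ) - 1) ^ 2 * Q with hM
  have hM0 : 0 ≤ M := by positivity
  have hle : ∑ a ∈ E, ‖wrS ψ k a ^ (s + 1) * (wrS ψ k (-a * t) - 1)‖ ≤
      Real.sqrt M ^ s * ∑ a ∈ E, ‖wrS ψ k a‖ * ‖wrS ψ k (-a * t) - 1‖ := by
    rw [Finset.mul_sum]
    apply Finset.sum_le_sum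
    intro a ha
    rw [norm_mul, norm_pow, pow_succ, mul_assoc]
    have : ‖wrS ψ k a‖ ≤ Real.sqrt M :=
      Real.le_sqrt_of_sq_le (wr_sup ψ hψ k hk d hd a (Finset.ne_of_mem_erase ha))
    gcongr
  have hcs := Finset.sum_mul_sq_le_sq_mul_sq E (fun a => ‖wrS ψ k a‖)
    (fun a => ‖wrS ψ k (-a * t) - 1‖)
  have hs2 := wr_sumS2 ψ hψ k hk d hd
  have hs3 := wr_sumS3 ψ hψ k hk d hd
  have hs3' : ∑ a ∈ E, ‖wrS ψ k (-a * t) - 1‖ ^ 2 = ∑ a ∈ E, ‖wrS ψ k a - 1‖ ^ 2 := by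
    apply Finset.sum_bij (fun a _ => -a * t)
    · intro a ha
      simp [hE] at ha ⊢
      exact ⟨ha, ht⟩
    · intro a _ b _ h
      exact neg_injective (mul_right_cancel₀ ht h)
    · intro b hb
      refine ⟨-(b / t), ?_, ?_⟩
      · simp [hE] at hb ⊢
        exact ⟨hb, ht⟩
      · field_simp
    · intro a _
      rfl
  rw [← hE] at hs2 hs3
  simp only [hs3'] at hcs
  set W := ∑ a ∈ E, ‖wrS ψ k a‖ * ‖wrS ψ k (-a * t) - 1‖ with hW
  have hW0 : 0 ≤ W := Finset.sum_nonneg fun a _ => by positivity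
  have hW2 : W ^ 2 ≤ (Q * (Q - 1) * (d - 1)) * ((Q - 1) * (Q * (d - 1) + 1)) := by
    refine hcs.trans (mul_le_mul hs2 hs3 (by positivity) (le_trans (by positivity) hs2))
  have hfin : (Q - 1) * Q ^ (s + 1) ≤ Real.sqrt M ^ s * W := by
    rw [hn]
    exact (norm_sum_le _ _).trans hle
  have hfin2 : ((Q - 1) * Q ^ (s + 1)) ^ 2 ≤ (Real.sqrt M ^ s * W) ^ 2 :=
    pow_le_pow_left₀ (mul_nonneg (by linarith) (by positivity)) hfin 2
  have e1 : (Real.sqrt M ^ s * W) ^ 2 = M ^ s * W ^ 2 := by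
    rw [mul_pow, ← pow_mul, mul_comm s 2, pow_mul, Real.sq_sqrt hM0]
  rw [e1] at hfin2
  have hfin3 : (Q - 1) ^ 2 * Q ^ (2 * (s + 1)) ≤
      (Q - 1) ^ 2 * (M ^ s * (Q * (d - 1) * (Q * (d - 1) + 1))) := by
    calc _ = ((Q - 1) * Q ^ (s + 1)) ^ 2 := by ring
      _ ≤ M ^ s * W ^ 2 := hfin2
      _ ≤ M ^ s * ((Q * (Q - 1) * (d - 1)) * ((Q - 1) * (Q * (d - 1) + 1))) := by gcongr
      _ = _ := by ring
  have := le_of_mul_le_mul_left hfin3 (by nlinarith)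
  linarith

lemma wr_two {K : Type*} [Field K] [Fintype K] (k : ℕ) (hk : 1 ≤ k)
    (h : (Nat.gcd k (Fintype.card K - 1) - 1) ^ 4 < Fintype.card K) (t : K) :
    ∃ x y : K, x ^ k + y ^ k = t := by
  classical
  by_cases ht : t = 0
  · exact ⟨0, 0, by simp [ht, show k ≠ 0 by omega]⟩
  obtain ⟨e, he⟩ : ∃ e, Nat.gcd k (Fintype.card K - 1) = e + 1 :=
    Nat.exists_eq_succ_of_ne_zero (Nat.gcd_pos_of_pos_left _ hk).ne'
  rw [he, Nat.add_sub_cancel] at h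
  obtain ⟨x, hx⟩ := wr_main _ (AddChar.FiniteField.primitiveChar_to_Complex_isPrimitive K) k hk
    (e + 1) he.symm 1 t ht (by
      push_cast
      generalize Fintype.card K = Q at *
      have : e ^ 4 + 1 ≤ Q := h
      have h' : (e:ℝ) ^ 4 + 1 ≤ Q := by exact_mod_cast this
      have he3 : (e:ℝ) ^ 3 < Q := by
        have : e ^ 3 ≤ e ^ 4 := by
          rcases Nat.eq_zero_or_pos e with rfl | h
          · simp
          · exact Nat.pow_le_pow_right h (by norm_num)
        exact_mod_cast (by omega : e ^ 3 < Q)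
      have hQ : (0:ℝ) < Q := by have : (0:ℝ) ≤ (e:ℝ) ^ 4 := by positivity
                                linarith
      have key : (e:ℝ) ^ 3 * (Q * e + 1) < Q ^ 2 := by nlinarith
      have : (Q:ℝ) ^ 2 * ((e:ℝ) ^ 3 * (Q * e + 1)) < Q ^ 2 * Q ^ 2 := by gcongr
      ring_nf at this ⊢
      linarith)
  exact ⟨x 0, x 1, by simpa [Fin.sum_univ_two] using hx⟩

lemma wr_three {K : Type*} [Field K] [Fintype K] (k : ℕ) (hk : 1 ≤ k)
    (h : (Nat.gcd k (Fintype.card K - 1) - 1) ^ 3 < Fintype.card K) (t : K) (ht : t ≠ 0) :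
    ∃ x y z : K, x ^ k + y ^ k + z ^ k = t := by
  classical
  obtain ⟨e, he⟩ : ∃ e, Nat.gcd k (Fintype.card K - 1) = e + 1 :=
    Nat.exists_eq_succ_of_ne_zero (Nat.gcd_pos_of_pos_left _ hk).ne'
  rw [he, Nat.add_sub_cancel] at h
  obtain ⟨x, hx⟩ := wr_main _ (AddChar.FiniteField.primitiveChar_to_Complex_isPrimitive K) k hk
    (e + 1) he.symm 2 t ht (by
      push_cast
      generalize Fintype.card K = Q at *
      have : e ^ 3 + 1 ≤ Q := h
      have h' : (e:ℝ) ^ 3 + 1 ≤ Q := by exact_mod_cast this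
      have he3 : (e:ℝ) ^ 5 ≤ (e:ℝ) ^ 3 * (e:ℝ) ^ 3 := by
        have : e ^ 5 ≤ e ^ 3 * e ^ 3 := by
          rcases Nat.eq_zero_or_pos e with rfl | h
          · simp
          · rw [← pow_add]; exact Nat.pow_le_pow_right h (by norm_num)
        exact_mod_cast this
      have h0 : (0:ℝ) ≤ (e:ℝ) ^ 3 := by positivity
      have hQ : (0:ℝ) < Q := by linarith
      have key : (e:ℝ) ^ 5 * (Q * e + 1) < Q ^ 3 := by
        have e6 : (e:ℝ) ^ 5 * (Q * e + 1) = (e:ℝ)^3 * (e:ℝ)^3 * Q + (e:ℝ)^5 := by ring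
        rw [e6]
        generalize (e:ℝ)^3 = u at *
        have : (u + 1)^2 ≤ (Q:ℝ)^2 := by gcongr
        nlinarith
      have : (Q:ℝ) ^ 3 * ((e:ℝ) ^ 5 * (Q * e + 1)) < Q ^ 3 * Q ^ 3 := by gcongr
      ring_nf at this ⊢
      linarith)
  exact ⟨x 0, x 1, x 2, by simpa [Fin.sum_univ_three] using hx⟩

open Polynomial in
lemma wr_poly {F : Type*} [Field F] (k : ℕ) (hkF : (k : F) ≠ 0) {ι : Type*} [DecidableEq ι]
    (a : ι → F) (ha : ∀ i, ∃ m, m ^ k = a i) (h0 : ∀ i j, a i = 0 → a j = 0 → i = j)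
    (s : Finset ι) : ∃ r : F[X], ∏ i ∈ s, (X - C (a i)) ∣ r ^ k - X := by
  induction s using Finset.induction_on with
  | empty => exact ⟨0, by simp⟩
  | insert i s his ih =>
    obtain ⟨r, hr⟩ := ih
    rw [Finset.prod_insert his]
    set f : F[X] := ∏ i ∈ s, (X - C (a i)) with hf
    by_cases hfi : f.eval (a i) = 0
    · have hai : a i ≠ 0 := by
        intro hz
        rw [hf, eval_prod, Finset.prod_eq_zero_iff] at hfi
        obtain ⟨j, hj, hj2⟩ := hfi
        simp [hz] at hj2
        exact his (h0 i j hz hj2 ▸ hj)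
      obtain ⟨h, hh⟩ := hr
      have hri : r.eval (a i) ≠ 0 := by
        intro hz
        have := congrArg (eval (a i)) hh
        have hk0 : k ≠ 0 := by rintro rfl; simp at hkF
        simp [hz, hfi, hk0] at this
        exact hai this
      set c : F := -h.eval (a i) / (k * r.eval (a i) ^ (k - 1)) with hc
      refine ⟨r + C c * f, ?_⟩
      obtain ⟨w, hw⟩ := Polynomial.powAddExpansion r (C c * f) k
      have e1 : (r + C c * f) ^ k - X =
          (h + (k : F[X]) * r ^ (k - 1) * C c + w * C c ^ 2 * f) * f := by
        rw [hw]
        linear_combination hh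
      rw [e1]
      apply mul_dvd_mul_right
      rw [dvd_iff_isRoot, IsRoot]
      simp only [eval_add, eval_mul, eval_pow, eval_C, hfi, eval_natCast]
      have : (k : F) * r.eval (a i) ^ (k - 1) ≠ 0 := mul_ne_zero hkF (pow_ne_zero _ hri)
      rw [hc]
      field_simp
      ring
    · obtain ⟨m, hm⟩ := ha i
      set c : F := (m - r.eval (a i)) / f.eval (a i) with hc
      refine ⟨r + C c * f, ?_⟩
      apply IsCoprime.mul_dvd
      · rw [(irreducible_X_sub_C (a i)).coprime_iff_not_dvd, dvd_iff_isRoot]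
        exact hfi
      · rw [dvd_iff_isRoot, IsRoot]
        have : r.eval (a i) + c * f.eval (a i) = m := by
          rw [hc]; field_simp; ring
        simp [this, hm]
      · have h1 : r + C c * f - r ∣ (r + C c * f) ^ k - r ^ k := sub_dvd_pow_sub_pow _ _ _
        have h2 : f ∣ (r + C c * f) ^ k - r ^ k :=
          dvd_trans ⟨C c, by ring⟩ h1
        have := dvd_add h2 hr
        simpa using this

lemma wr_upper {F : Type*} [Field F] (k : ℕ) (hkF : (k : F) ≠ 0) {n : ℕ}
    (U : Matrix (Fin n) (Fin n) F) (hU : U.charpoly = ∏ i, (Polynomial.X - Polynomial.C (U i i)))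
    (ha : ∀ i, ∃ m, m ^ k = U i i) (h0 : ∀ i j, U i i = 0 → U j j = 0 → i = j) :
    ∃ A, U = A ^ k := by
  obtain ⟨r, h, hr⟩ := wr_poly k hkF (fun i => U i i) ha h0 Finset.univ
  rw [← hU] at hr
  refine ⟨Polynomial.aeval U r, ?_⟩
  have := congrArg (Polynomial.aeval U) hr
  simp only [map_sub, map_pow, map_mul, Matrix.aeval_self_charpoly, zero_mul,
    Polynomial.aeval_X] at this
  exact (sub_eq_zero.1 this).symm

/-- a matrix whose diagonal splits well -/
lemma wr_split {F : Type*} [Field F] (k : ℕ) (hkF : (k : F) ≠ 0) {n : ℕ}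
    (M : Matrix (Fin n) (Fin n) F) (α β : Fin n → F) (hM : ∀ i, M i i = α i + β i)
    (ha : ∀ i, ∃ m, m ^ k = α i) (ha0 : ∀ i j, α i = 0 → α j = 0 → i = j)
    (hb : ∀ i, ∃ m, m ^ k = β i) (hb0 : ∀ i j, β i = 0 → β j = 0 → i = j) :
    ∃ A B : Matrix (Fin n) (Fin n) F, M = A ^ k + B ^ k := by
  set L : Matrix (Fin n) (Fin n) F := fun i j => if j < i then M i j else if i = j then α i else 0
    with hL
  set U : Matrix (Fin n) (Fin n) F := fun i j => if i < j then M i j else if i = j then β i else 0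
    with hU
  have hLU : M = L + U := by
    ext i j
    rw [Matrix.add_apply]
    simp only [hL, hU]
    rcases lt_trichotomy i j with h | h | h
    · simp [h, h.not_gt, h.ne]
    · subst h; simp [hM]
    · simp [h, h.not_gt, h.ne']
  have hLd : ∀ i, L i i = α i := fun i => by simp [hL]
  have hUd : ∀ i, U i i = β i := fun i => by simp [hU]
  have hUc : U.charpoly = ∏ i, (Polynomial.X - Polynomial.C (U i i)) := by
    apply Matrix.charpoly_of_isUpperTriangular
    intro i j hij
    simp only [id] at hij
    simp [hU, hij.not_gt, hij.ne']
  have hLc : L.charpoly = ∏ i, (Polynomial.X - Polynomial.C (L i i)) := by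
    rw [← Matrix.charpoly_transpose, Matrix.charpoly_of_isUpperTriangular]
    · rfl
    · intro i j hij
      simp only [id] at hij
      rw [Matrix.transpose_apply]
      simp [hL, hij.not_gt, hij.ne]
  obtain ⟨A, hA⟩ := wr_upper k hkF L hLc (by simpa [hLd] using ha) (by simpa [hLd] using ha0)
  obtain ⟨B, hB⟩ := wr_upper k hkF U hUc (by simpa [hUd] using hb) (by simpa [hUd] using hb0)
  exact ⟨A, B, by rw [hLU, ← hA, ← hB]⟩

section
open Matrix

lemma wr_T {F : Type*} [Field F] {n : ℕ} (u w : Fin n → F) (h : w ⬝ᵥ u = 0) :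
    (1 + vecMulVec u w) * (1 - vecMulVec u w) = 1 := by
  have : vecMulVec u w * vecMulVec u w = 0 := by
    rw [vecMulVec_mul_vecMulVec, h, zero_smul, ]
    ext i j; simp [vecMulVec]
  rw [mul_sub, add_mul, add_mul, this]
  simp

lemma wr_ent {F : Type*} [Field F] {n : ℕ} (u w : Fin n → F) (M : Matrix (Fin n) (Fin n) F)
    (a b : Fin n) :
    ((1 - vecMulVec u w) * M * (1 + vecMulVec u w)) a b =
      M a b + (M *ᵥ u) a * w b - u a * (w ᵥ* M) b - u a * ((w ᵥ* M) ⬝ᵥ u) * w b := by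
  have e : (1 - vecMulVec u w) * M * (1 + vecMulVec u w) =
      M + M * vecMulVec u w - vecMulVec u w * M - vecMulVec u w * M * vecMulVec u w := by
    noncomm_ring
  rw [e, mul_vecMulVec, vecMulVec_mul, vecMulVec_mul_vecMulVec]
  simp [vecMulVec_apply]
  ring

lemma wr_conj {F : Type*} [Field F] {n : ℕ} (k : ℕ) (P P' M : Matrix (Fin n) (Fin n) F)
    (h : P * P' = 1) (hN : ∃ A B : Matrix (Fin n) (Fin n) F, P' * M * P = A ^ k + B ^ k) :
    ∃ A B : Matrix (Fin n) (Fin n) F, M = A ^ k + B ^ k := by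
  have h' : P' * P = 1 := mul_eq_one_comm.1 h
  obtain ⟨A, B, hAB⟩ := hN
  have hp : ∀ (C : Matrix (Fin n) (Fin n) F) (k : ℕ), (P * C * P') ^ k = P * C ^ k * P' := by
    intro C k
    induction k with
    | zero => simp [h]
    | succ k ih =>
      rw [pow_succ, ih, pow_succ]
      calc P * C ^ k * P' * (P * C * P') = P * C ^ k * (P' * P) * C * P' := by
            simp only [mul_assoc]
        _ = _ := by rw [h']; simp only [mul_assoc, one_mul]
  refine ⟨P * A * P', P * B * P', ?_⟩
  rw [hp, hp, ← add_mul, ← mul_add, ← hAB]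
  calc M = (P * P') * M * (P * P') := by rw [h]; simp
    _ = _ := by simp only [mul_assoc]

/-- Non-scalar matrices: the diagonal can be prescribed. -/
lemma wr_nonscalar {F : Type*} [Field F] {n : ℕ} (k : ℕ) (M : Matrix (Fin n) (Fin n) F)
    (hM : ∀ c : F, M ≠ scalar _ c) (c : Fin n → F) (hc : ∑ i, c i = M.trace)
    (hgood : ∀ N : Matrix (Fin n) (Fin n) F, (∀ i, N i i = c i) →
      ∃ A B : Matrix (Fin n) (Fin n) F, N = A ^ k + B ^ k) :
    ∃ A B : Matrix (Fin n) (Fin n) F, M = A ^ k + B ^ k := by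
  have htr : ∀ (N : Matrix (Fin n) (Fin n) F) (u w : Fin n → F), w ⬝ᵥ u = 0 →
      ((1 - vecMulVec u w) * N * (1 + vecMulVec u w)).trace = N.trace := by
    intro N u w h
    rw [Matrix.trace_mul_comm, ← mul_assoc, wr_T u w h, one_mul]
  -- step B
  have hB : ∀ (N : Matrix (Fin n) (Fin n) F) (j : Fin n), (∀ l, l ≠ j → N l j ≠ 0) →
      ∑ i, c i = N.trace → ∃ A B : Matrix (Fin n) (Fin n) F, N = A ^ k + B ^ k := by
    intro N j hN hcN
    set u : Fin n → F := Pi.single j 1 with hu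
    set w : Fin n → F := fun l => if l = j then 0 else (c l - N l l) / N l j with hw
    have huw : w ⬝ᵥ u = 0 := by simp [hu, hw]
    apply wr_conj k _ _ N (wr_T u w huw)
    apply hgood
    have hl : ∀ l, l ≠ j → ((1 - vecMulVec u w) * N * (1 + vecMulVec u w)) l l = c l := by
      intro l hlj
      rw [wr_ent]
      have := hN l hlj
      simp [hu, hw, hlj]
      field_simp
      ring
    intro i
    by_cases hij : i = j
    · subst hij
      have h1 := htr N u w huw
      rw [← hcN, Matrix.trace, ← Finset.add_sum_erase _ _ (Finset.mem_univ i),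
        ← Finset.add_sum_erase Finset.univ c (Finset.mem_univ i)] at h1
      rw [Finset.sum_congr rfl (g := c)] at h1
      · exact add_right_cancel h1
      · intro l hl'
        exact hl l (Finset.ne_of_mem_erase hl')
    · exact hl i hij
  -- step A
  have hA : ∀ (N : Matrix (Fin n) (Fin n) F) (i j : Fin n), i ≠ j → N i j ≠ 0 →
      ∑ i, c i = N.trace → ∃ A B : Matrix (Fin n) (Fin n) F, N = A ^ k + B ^ k := by
    intro N i j hij hN hcN
    set w : Fin n → F := Pi.single i 1 with hw
    set u : Fin n → F := fun l => if l = i ∨ l = j then 0 else (N l j - 1) / N i j with hu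
    have huw : w ⬝ᵥ u = 0 := by simp [hu, hw]
    apply wr_conj k _ _ N (wr_T u w huw)
    apply hB _ j _ (by rw [htr N u w huw, hcN])
    intro l hl
    rw [wr_ent]
    by_cases hli : l = i
    · subst hli
      simp [hw, hu, hij.symm, hN]
    · simp [hw, hu, hij.symm, hli, hl, hN]
  by_cases hoff : ∃ i j, i ≠ j ∧ M i j ≠ 0
  · obtain ⟨i, j, hij, h⟩ := hoff
    exact hA M i j hij h hc
  · push Not at hoff
    have : ∃ i j, M i i ≠ M j j := by
      by_contra hcon
      push Not at hcon
      rcases Nat.eq_zero_or_pos n with rfl | hn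
      · exact hM 0 (Subsingleton.elim _ _)
      · apply hM (M ⟨0, hn⟩ ⟨0, hn⟩)
        ext i j
        by_cases hij : i = j
        · subst hij; simp [hcon i ⟨0, hn⟩]
        · simp [hij, hoff i j hij]
    obtain ⟨i, j, hij⟩ := this
    have hne : i ≠ j := fun h => hij (by rw [h])
    set u : Fin n → F := Pi.single i 1 with hu
    set w : Fin n → F := Pi.single j 1 with hw
    have huw : w ⬝ᵥ u = 0 := by simp [hu, hw, hne]
    apply wr_conj k _ _ M (wr_T u w huw)
    apply hA _ i j hne _ (by rw [htr M u w huw, hc])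
    rw [wr_ent]
    simp [hu, hw, hoff i j hne, hoff j i hne.symm, sub_eq_zero, hij]

lemma wr_scalar_ext {F : Type*} [Field F] {m : ℕ} (k : ℕ) (K : Type*) [Field K] [Algebra F K]
    [Module.Finite F K] (hm : Module.finrank F K = m)
    (hK : ∀ t : K, ∃ x y : K, x ^ k + y ^ k = t) (c : F) :
    ∃ A B : Matrix (Fin m) (Fin m) F, scalar _ c = A ^ k + B ^ k := by
  obtain ⟨x, y, hxy⟩ := hK (algebraMap F K c)
  set b := Module.finBasisOfFinrankEq F K hm
  refine ⟨Algebra.leftMulMatrix b x, Algebra.leftMulMatrix b y, ?_⟩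
  rw [← map_pow, ← map_pow, ← map_add, hxy, AlgHom.commutes]
  rfl

lemma wr_scalar_add {F : Type*} [Field F] {m n : ℕ} (k : ℕ) (c : F)
    (h1 : ∃ A B : Matrix (Fin m) (Fin m) F, scalar _ c = A ^ k + B ^ k)
    (h2 : ∃ A B : Matrix (Fin n) (Fin n) F, scalar _ c = A ^ k + B ^ k) :
    ∃ A B : Matrix (Fin (m + n)) (Fin (m + n)) F, scalar _ c = A ^ k + B ^ k := by
  obtain ⟨A, B, h⟩ := h1
  obtain ⟨A', B', h'⟩ := h2
  refine ⟨reindexAlgEquiv F F finSumFinEquiv (fromBlocks A 0 0 A'),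
    reindexAlgEquiv F F finSumFinEquiv (fromBlocks B 0 0 B'), ?_⟩
  rw [← map_pow, ← map_pow, ← map_add, fromBlocks_diagonal_pow, fromBlocks_diagonal_pow,
    fromBlocks_add, ← h, ← h']
  rw [eq_comm]
  have : fromBlocks (scalar (Fin m) c) (0 + 0) (0 + 0) (scalar (Fin n) c) =
      algebraMap F (Matrix (Fin m ⊕ Fin n) (Fin m ⊕ Fin n) F) c := by
    ext i j
    rcases i with i | i <;> rcases j with j | j <;>
      simp [Matrix.algebraMap_matrix_apply, Matrix.diagonal_apply]
  rw [this, AlgEquiv.commutes]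
  rfl

end

/-- Every element is a sum of four powers, each pair having a nonzero member. -/
lemma wr_four {F : Type*} [Field F] [Fintype F] (k : ℕ) (hk : 1 ≤ k)
    (h1 : Fintype.card F ^ 2 ≥ (Nat.gcd k (Fintype.card F - 1) - 1) ^ 6 +
      6 * Nat.gcd k (Fintype.card F - 1)) (t : F) :
    ∃ x y z w : F, (x ≠ 0 ∨ y ≠ 0) ∧ w ≠ 0 ∧ x ^ k + y ^ k + (z ^ k + w ^ k) = t := by
  classical
  have hk0 : k ≠ 0 := by omega
  have hpos : 0 < Nat.gcd k (Fintype.card F - 1) := Nat.gcd_pos_of_pos_left _ hk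
  have hq : 1 < Fintype.card F := Fintype.one_lt_card
  have h3 : (Nat.gcd k (Fintype.card F - 1) - 1) ^ 3 < Fintype.card F := by
    by_contra hcon
    push Not at hcon
    have h2 : Fintype.card F ^ 2 ≤ ((Nat.gcd k (Fintype.card F - 1) - 1) ^ 3) ^ 2 :=
      Nat.pow_le_pow_left hcon 2
    rw [← pow_mul, show 3 * 2 = 6 from rfl] at h2
    omega
  -- a nonzero `w` with `w ^ k ≠ t`
  have hw : ∃ w : F, w ≠ 0 ∧ w ^ k ≠ t := by
    by_contra hcon
    push Not at hcon
    have hone : ∀ w : F, w ≠ 0 → (1:F) ^ k = w ^ k := fun w hw => by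
      rw [hcon w hw, hcon 1 one_ne_zero]
    have hc := wr_rootcount k hk (1:F) one_ne_zero
    have hsub : (Finset.univ.erase (0:F)) ⊆ Finset.univ.filter (fun y : F => (1:F) ^ k = y ^ k) := by
      intro w hw
      simp only [Finset.mem_filter, Finset.mem_univ, true_and]
      exact hone w (Finset.ne_of_mem_erase hw)
    have hc2 := (Finset.card_le_card hsub).trans hc
    rw [Finset.card_erase_of_mem (Finset.mem_univ _), Finset.card_univ] at hc2
    have hle : Nat.gcd k (Fintype.card F - 1) ≤ Fintype.card F - 1 :=
      Nat.gcd_le_right _ (by omega)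
    have he : Nat.gcd k (Fintype.card F - 1) = Fintype.card F - 1 := le_antisymm hle hc2
    rw [he] at h1
    obtain ⟨m, hm⟩ : ∃ m, Fintype.card F = m + 2 := ⟨Fintype.card F - 2, by omega⟩
    rw [hm, show m + 2 - 1 - 1 = m by omega, show m + 2 - 1 = m + 1 by omega] at h1
    rcases Nat.lt_or_ge m 2 with hm2 | hm2
    · interval_cases m <;> omega
    · have : 2 ^ 4 * m ^ 2 ≤ m ^ 4 * m ^ 2 := Nat.mul_le_mul_right _ (Nat.pow_le_pow_left hm2 4)
      have e : m ^ 4 * m ^ 2 = m ^ 6 := by ring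
      nlinarith
  obtain ⟨w, hw0, hwt⟩ := hw
  obtain ⟨x, y, z, hxyz⟩ := wr_three k hk h3 (t - w ^ k) (sub_ne_zero.2 (Ne.symm hwt))
  by_cases hx : x = 0
  · by_cases hy : y = 0
    · have hz : z ≠ 0 := by
        rintro rfl
        simp [hx, hy, hk0] at hxyz
        exact hwt (sub_eq_zero.1 hxyz.symm).symm
      exact ⟨z, y, x, w, Or.inl hz, hw0, by linear_combination hxyz⟩
    · exact ⟨x, y, z, w, Or.inr hy, hw0, by linear_combination hxyz⟩
  · exact ⟨x, y, z, w, Or.inl hx, hw0, by linear_combination hxyz⟩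

/-- Assigning powers to the diagonal places. -/
def wrAssign {F : Type*} [Field F] (m : ℕ) (x y : F) : Fin (m + 2) → F :=
  Fin.cons x (Fin.cons y (fun _ => 1))

lemma wr_assign_sum {F : Type*} [Field F] (m : ℕ) (x y : F) :
    ∑ i, wrAssign m x y i = x + y + m := by
  simp [wrAssign, Fin.sum_univ_succ]
  ring

lemma wr_assign_pow {F : Type*} [Field F] (m k : ℕ) (x y : F) (i : Fin (m + 2)) :
    ∃ a, a ^ k = wrAssign m (x ^ k) (y ^ k) i := by
  unfold wrAssign
  refine Fin.cases ⟨x, rfl⟩ (fun i => Fin.cases ⟨y, rfl⟩ (fun i => ⟨1, ?_⟩) i) i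
  simp

lemma wr_assign_zero {F : Type*} [Field F] (m : ℕ) (x y : F) (h : x ≠ 0 ∨ y ≠ 0)
    (i j : Fin (m + 2)) (hi : wrAssign m x y i = 0) (hj : wrAssign m x y j = 0) : i = j := by
  unfold wrAssign at *
  induction i using Fin.cases with
  | zero =>
    induction j using Fin.cases with
    | zero => rfl
    | succ j =>
      induction j using Fin.cases with
      | zero => simp at hi hj; simp [hi, hj] at h
      | succ j => simp at hj
  | succ i =>
    induction i using Fin.cases with
    | zero =>
      induction j using Fin.cases with
      | zero => simp at hi hj; simp [hi, hj] at h
      | succ j =>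
        induction j using Fin.cases with
        | zero => rfl
        | succ j => simp at hj
    | succ i => simp at hi

lemma wr_scalar_all {F : Type*} [Field F] (k : ℕ) (c : F)
    (h2 : ∃ A B : Matrix (Fin 2) (Fin 2) F, Matrix.scalar _ c = A ^ k + B ^ k)
    (h3 : ∃ A B : Matrix (Fin 3) (Fin 3) F, Matrix.scalar _ c = A ^ k + B ^ k) (m : ℕ) :
    ∃ A B : Matrix (Fin (m + 2)) (Fin (m + 2)) F, Matrix.scalar _ c = A ^ k + B ^ k := by
  induction m using Nat.twoStepInduction with
  | zero => exact h2
  | one => exact h3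
  | more m ih _ => exact wr_scalar_add k c ih h2

lemma wr_scalar_deg (p : ℕ) (hp : p.Prime) (F : Type*) [Field F] [Fintype F] [CharP F p]
    (k m : ℕ) (hk : 1 ≤ k) (hm : m ≠ 0)
    (h : (Nat.gcd k (Fintype.card F ^ m - 1) - 1) ^ 4 < Fintype.card F ^ m) (c : F) :
    ∃ A B : Matrix (Fin m) (Fin m) F, Matrix.scalar _ c = A ^ k + B ^ k := by
  have : Fact p.Prime := ⟨hp⟩
  have : NeZero m := ⟨hm⟩
  have := Fintype.ofFinite (FiniteField.Extension F p m)
  have hcard : Fintype.card (FiniteField.Extension F p m) = Fintype.card F ^ m := by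
    have := FiniteField.natCard_extension F p m
    rwa [Nat.card_eq_fintype_card, Nat.card_eq_fintype_card] at this
  exact wr_scalar_ext k (FiniteField.Extension F p m) (FiniteField.finrank_extension F p m)
    (fun t => wr_two k hk (by rw [hcard]; exact h) t) c

theorem stmt10 (p : ℕ) (hp : p.Prime) (F : Type*) [Field F] [Fintype F] [CharP F p]
    (k n : ℕ) (hk : 1 ≤ k) (hn : 2 ≤ n) (hpk : ¬ p ∣ k)
    (d d2 d3 : ℕ) (hd : d = Nat.gcd k (Fintype.card F - 1))
    (hd2 : d2 = Nat.gcd k (Fintype.card F ^ 2 - 1))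
    (hd3 : d3 = Nat.gcd k (Fintype.card F ^ 3 - 1))
    (h1 : Fintype.card F ^ 2 ≥ (d - 1) ^ 6 + 6 * d)
    (h2 : Fintype.card F > (d2 - 1) ^ 2)
    (h3 : Fintype.card F ^ 3 > (d3 - 1) ^ 4) :
    ∀ M : Matrix (Fin n) (Fin n) F, ∃ A B : Matrix (Fin n) (Fin n) F,
      M = A ^ k + B ^ k := by
  intro M
  have hkF : (k : F) ≠ 0 := by
    rw [Ne, CharP.cast_eq_zero_iff F p]
    exact hpk
  obtain ⟨m, rfl⟩ : ∃ m, n = m + 2 := ⟨n - 2, by omega⟩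
  subst hd hd2 hd3
  by_cases hM : ∃ c : F, M = Matrix.scalar _ c
  · obtain ⟨c, rfl⟩ := hM
    apply wr_scalar_all
    · apply wr_scalar_deg p hp F k 2 hk (by norm_num)
      have := Nat.pow_lt_pow_left h2 (n := 2) (by norm_num)
      rwa [← pow_mul] at this
    · exact wr_scalar_deg p hp F k 3 hk (by norm_num) h3 c
  · push Not at hM
    obtain ⟨x, y, z, w, hxy, hw, hsum⟩ := wr_four k hk h1 (M.trace - m - m)
    have hk0 : k ≠ 0 := by omega
    apply wr_nonscalar k M hM
      (fun i => wrAssign m (x ^ k) (y ^ k) i + wrAssign m (z ^ k) (w ^ k) i)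
    · rw [Finset.sum_add_distrib, wr_assign_sum, wr_assign_sum]
      linear_combination hsum
    · intro N hN
      refine wr_split k hkF N _ _ hN (wr_assign_pow m k x y) ?_ (wr_assign_pow m k z w) ?_
      · exact wr_assign_zero m _ _ (hxy.imp (pow_ne_zero k) (pow_ne_zero k))
      · exact wr_assign_zero m _ _ (Or.inr (pow_ne_zero k hw))
end
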